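/- arXiv:1311.5878 — 4 statements merged into one kernel-verified Lean document; each statement's English description precedes it below -/
import Mathlib

section
/- Let X be an irreducible one-step shift of finite type, π : X → Y a one-block factor code onto Y, and X̄ a proper subshift of X with π(X̄) = Y. Then for each block v̄ ∈ B(X) \ B(X̄) there exist blocks u, v ∈ B(X) forming an (X̄, v̄)-diamond: π(u) = π(v), v̄ is a subblock of v, u occurs in X̄, and u and v share the same initial symbol and the same terminal symbol. -/
open Set

universe u v uc

variable {A : Type u} {B : Type v}

/-- The shift by `n` on points of the full shift `ℤ → A`. -/
def shiftMap (n : ℤ) (x : ℤ → A) : ℤ → A := fun i => x (i + n)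

/-- A subshift: a closed, shift-invariant subset of the full shift. -/
def IsSubshift [TopologicalSpace A] (X : Set (ℤ → A)) : Prop :=
  IsClosed X ∧ ∀ n : ℤ, ∀ x ∈ X, shiftMap n x ∈ X

/-- The block `u` (of length `p`) occurs in `X`. -/
def OccursIn {p : ℕ} (u : Fin p → A) (X : Set (ℤ → A)) : Prop :=
  ∃ x ∈ X, ∃ i : ℤ, ∀ j : Fin p, x (i + (j.1 : ℤ)) = u j

/-- A shift of finite type: a subshift determined by a set of allowed `k`-blocks. -/
def IsSFT [TopologicalSpace A] (X : Set (ℤ → A)) : Prop :=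
  IsSubshift X ∧ ∃ (k : ℕ) (P : (Fin k → A) → Prop),
    X = {x | ∀ i : ℤ, P fun j => x (i + (j.1 : ℤ))}

/-- A one-step shift of finite type: determined by allowed 2-blocks. -/
def IsOneStep [TopologicalSpace A] (X : Set (ℤ → A)) : Prop :=
  IsSubshift X ∧ ∃ T : A → A → Prop, X = {x | ∀ i : ℤ, T (x i) (x (i + 1))}

/-- Irreducibility: any two blocks of `X` can be seen in a single point of `X`,
the second occurring after the first. -/
def IrreducibleSubshift [TopologicalSpace A] (X : Set (ℤ → A)) : Prop :=
  ∀ (p q : ℕ) (u : Fin p → A) (w : Fin q → A),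
    OccursIn u X → OccursIn w X →
      ∃ x ∈ X, ∃ i k : ℤ, i + (p : ℤ) ≤ k ∧
        (∀ j : Fin p, x (i + (j.1 : ℤ)) = u j) ∧ ∀ j : Fin q, x (k + (j.1 : ℤ)) = w j

/-- A sliding block code: given by a local rule on a finite window. -/
def IsSlidingBlockCode (π : (ℤ → A) → ℤ → B) : Prop :=
  ∃ (r : ℕ) (Φ : (Fin (2 * r + 1) → A) → B),
    ∀ x i, π x i = Φ fun j => x (i - (r : ℤ) + (j.1 : ℤ))

/-- A one-block code. -/
def IsOneBlock (π : (ℤ → A) → ℤ → B) : Prop :=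
  ∃ Φ : A → B, ∀ x i, π x i = Φ (x i)

/-- `Φ` is a one-block local rule for `π`. -/
def OneBlockRule (π : (ℤ → A) → ℤ → B) (Φ : A → B) : Prop :=
  ∀ x i, π x i = Φ (x i)

/-- A factor code from `X` onto `Y`. -/
def IsFactorCode (X : Set (ℤ → A)) (Y : Set (ℤ → B)) (π : (ℤ → A) → ℤ → B) : Prop :=
  IsSlidingBlockCode π ∧ (∀ x ∈ X, π x ∈ Y) ∧ ∀ y ∈ Y, ∃ x ∈ X, π x = y

/-- A factor triple: a factor code from an SFT `X` onto the subshift `Y`. -/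
def FactorTriple [TopologicalSpace A] [TopologicalSpace B]
    (X : Set (ℤ → A)) (Y : Set (ℤ → B)) (π : (ℤ → A) → ℤ → B) : Prop :=
  IsSFT X ∧ IsSubshift Y ∧ IsFactorCode X Y π

/-- Transition `x → x'`: for each `n` there is `z` in the fiber agreeing with `x`
on `(-∞, n]` and with `x'` on `[i, ∞)` for some `i ≥ n`. -/
def TransitionTo (X : Set (ℤ → A)) (π : (ℤ → A) → ℤ → B) (x x' : ℤ → A) : Prop :=
  ∀ n : ℤ, ∃ z ∈ X, π z = π x ∧ (∀ m ≤ n, z m = x m) ∧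
    ∃ i : ℤ, n ≤ i ∧ ∀ m : ℤ, i ≤ m → z m = x' m

/-- `x ~ x'`: transitions in both directions. -/
def TransEquiv (X : Set (ℤ → A)) (π : (ℤ → A) → ℤ → B) (x x' : ℤ → A) : Prop :=
  TransitionTo X π x x' ∧ TransitionTo X π x' x

/-- The transition class of `x` (within the fiber of `π x`). -/
def transClass (X : Set (ℤ → A)) (π : (ℤ → A) → ℤ → B) (x : ℤ → A) : Set (ℤ → A) :=
  {x' | x' ∈ X ∧ π x' = π x ∧ TransEquiv X π x x'}

/-- The set of transition classes over `y`. -/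
def transClassesOver (X : Set (ℤ → A)) (π : (ℤ → A) → ℤ → B) (y : ℤ → B) :
    Set (Set (ℤ → A)) :=
  {C | ∃ x, x ∈ X ∧ π x = y ∧ C = transClass X π x}

/-- Right transitive point: its forward orbit is dense in `X`. -/
def RightTransitive (X : Set (ℤ → A)) (x : ℤ → A) : Prop :=
  x ∈ X ∧ ∀ z ∈ X, ∀ N : ℕ, ∃ n : ℤ, 0 ≤ n ∧ ∀ m : ℤ, |m| ≤ (N : ℤ) → x (m + n) = z m

/-- Left transitive point: its backward orbit is dense in `X`. -/
def LeftTransitive (X : Set (ℤ → A)) (x : ℤ → A) : Prop :=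
  x ∈ X ∧ ∀ z ∈ X, ∀ N : ℕ, ∃ n : ℤ, n ≤ 0 ∧ ∀ m : ℤ, |m| ≤ (N : ℤ) → x (m + n) = z m

/-- Doubly transitive point. -/
def DoublyTransitive (X : Set (ℤ → A)) (x : ℤ → A) : Prop :=
  RightTransitive X x ∧ LeftTransitive X x

def MutuallySeparated (x x' : ℤ → A) : Prop := ∀ i : ℤ, x i ≠ x' i

def RightAsymptotic (x x' : ℤ → A) : Prop := ∃ N : ℤ, ∀ m : ℤ, N ≤ m → x m = x' m

def LeftAsymptotic (x x' : ℤ → A) : Prop := ∃ N : ℤ, ∀ m : ℤ, m ≤ N → x m = x' m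

/-- The class degree: the minimal number of transition classes over points of `Y`. -/
noncomputable def classDegree (X : Set (ℤ → A)) (Y : Set (ℤ → B))
    (π : (ℤ → A) → ℤ → B) : ℕ :=
  sInf {d | ∃ y ∈ Y, Nat.card (transClassesOver X π y) = d}

/-- The preimage blocks of a `Y`-block `w` under the one-block rule `Φ`. -/
def blockPre (X : Set (ℤ → A)) (Φ : A → B) {p : ℕ} (w : Fin p → B) : Set (Fin p → A) :=
  {u | OccursIn u X ∧ ∀ j, Φ (u j) = w j}

/-- `u ∈ π⁻¹(w)` is routable through `a` at time `n`. -/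
def Routable (X : Set (ℤ → A)) (Φ : A → B) {p : ℕ} (w : Fin (p + 1) → B)
    (u : Fin (p + 1) → A) (n : Fin (p + 1)) (a : A) : Prop :=
  ∃ u' ∈ blockPre X Φ w, u' 0 = u 0 ∧ u' (Fin.last p) = u (Fin.last p) ∧ u' n = a

/-- `(w, n, M)` is a transition block. -/
def IsTransBlock (X : Set (ℤ → A)) (Y : Set (ℤ → B)) (Φ : A → B) {p : ℕ}
    (w : Fin (p + 1) → B) (n : Fin (p + 1)) (M : Set A) : Prop :=
  OccursIn w Y ∧ 0 < n.1 ∧ n.1 < p ∧ (∀ a ∈ M, Φ a = w n) ∧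
    ∀ u ∈ blockPre X Φ w, ∃ a ∈ M, Routable X Φ w u n a

/-- `c*_π`: the minimal depth of a transition block. -/
noncomputable def minDepth (X : Set (ℤ → A)) (Y : Set (ℤ → B)) (Φ : A → B) : ℕ :=
  sInf {d | ∃ (p : ℕ) (w : Fin (p + 1) → B) (n : Fin (p + 1)) (M : Set A),
    IsTransBlock X Y Φ w n M ∧ Nat.card M = d}

/-- A minimal transition block. -/
def IsMinTransBlock (X : Set (ℤ → A)) (Y : Set (ℤ → B)) (Φ : A → B) {p : ℕ}
    (w : Fin (p + 1) → B) (n : Fin (p + 1)) (M : Set A) : Prop :=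
  IsTransBlock X Y Φ w n M ∧ Nat.card M = minDepth X Y Φ

/-- `d(w)`: the minimal number of symbols seen at a single coordinate among
the preimages of `w`. -/
noncomputable def dval (X : Set (ℤ → A)) (Φ : A → B) {p : ℕ} (w : Fin p → B) : ℕ :=
  sInf {m | ∃ k : Fin p, Nat.card {a : A | ∃ u ∈ blockPre X Φ w, u k = a} = m}

/-- A magic block: a block of `Y` minimizing `d(·)`. -/
def IsMagicBlock (X : Set (ℤ → A)) (Y : Set (ℤ → B)) (Φ : A → B) {p : ℕ}
    (w : Fin (p + 1) → B) : Prop :=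
  OccursIn w Y ∧
    dval X Φ w = sInf {m | ∃ (q : ℕ) (v : Fin (q + 1) → B), OccursIn v Y ∧ dval X Φ v = m}

/-- An `(X̄, v̄)`-diamond: blocks `u, v` of `X` with the same image, same
endpoints, `u` occurring in `X̄` and `v̄` a subblock of `v`. -/
def IsDiamond (X Xbar : Set (ℤ → A)) (Φ : A → B) {q p : ℕ} (vbar : Fin q → A)
    (u v : Fin (p + 1) → A) : Prop :=
  OccursIn u Xbar ∧ OccursIn v X ∧ (∀ j, Φ (u j) = Φ (v j)) ∧
    (∃ (s : ℕ) (_ : s + q ≤ p + 1), ∀ j : Fin q,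
      v ⟨s + j.1, by have := j.2; omega⟩ = vbar j) ∧
    u 0 = v 0 ∧ u (Fin.last p) = v (Fin.last p)

/-- Reversed transition `x →_r x'`. -/
def RevTransitionTo (X : Set (ℤ → A)) (π : (ℤ → A) → ℤ → B) (x x' : ℤ → A) : Prop :=
  ∀ n : ℤ, ∃ z ∈ X, π z = π x ∧ (∀ m : ℤ, n ≤ m → z m = x' m) ∧
    ∃ i : ℤ, i ≤ n ∧ ∀ m ≤ i, z m = x m

def RevTransEquiv (X : Set (ℤ → A)) (π : (ℤ → A) → ℤ → B) (x x' : ℤ → A) : Prop :=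
  RevTransitionTo X π x x' ∧ RevTransitionTo X π x' x

/-- The reversed transition class of `x`. -/
def revClass (X : Set (ℤ → A)) (π : (ℤ → A) → ℤ → B) (x : ℤ → A) : Set (ℤ → A) :=
  {x' | x' ∈ X ∧ π x' = π x ∧ RevTransEquiv X π x x'}

open scoped Classical in
/-- The standard metric on the full shift. -/
noncomputable def shiftDist (x x' : ℤ → A) : ℝ :=
  if x = x' then 0
  else
    let k : ℕ := sInf {k : ℕ | x (k : ℤ) ≠ x' (k : ℤ) ∨ x (-(k : ℤ)) ≠ x' (-(k : ℤ))}
    (2 : ℝ) ^ (-(k : ℤ))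

/-- The paths allowed by the transition relation `T`. -/
def PathSet (T : A → A → Prop) : Set (ℤ → A) := {x | ∀ i : ℤ, T (x i) (x (i + 1))}

theorem pathSet_shift {T : A → A → Prop} {x : ℤ → A} (hx : x ∈ PathSet T) (n : ℤ) :
    (fun i => x (i + n)) ∈ PathSet T := by
  intro i
  have := hx (i + n)
  have e : i + n + 1 = i + 1 + n := by ring
  rw [e] at this
  exact this

theorem pathSet_splice {T : A → A → Prop} {x z : ℤ → A} (hx : x ∈ PathSet T)
    (hz : z ∈ PathSet T) (n : ℤ) (h : x n = z n) :
    (fun i => if i ≤ n then x i else z i) ∈ PathSet T := by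
  intro i
  by_cases h1 : i + 1 ≤ n
  · have h2 : i ≤ n := by omega
    simp only [h1, h2, if_true]
    exact hx i
  · by_cases h2 : i ≤ n
    · have h3 : i = n := by omega
      subst h3
      simp only [h1, le_refl, if_true, if_false]
      rw [h]
      exact hz i
    · simp only [h1, h2, if_false]
      exact hz i

/-- There is a path of `k` periods from `b` to `c` over the image of `x`; when `β` holds
it contains `vbar`. -/
def PRel (T : A → A → Prop) (Φ : A → B) (x : ℤ → A) (P : ℤ) {q : ℕ} (vbar : Fin q → A)
    (β : Prop) (k : ℤ) (b c : A) : Prop :=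
  ∃ g ∈ PathSet T, g 0 = b ∧ g (k * P) = c ∧
    (∀ i : ℤ, 0 ≤ i → i ≤ k * P → Φ (g i) = Φ (x i)) ∧
    (β → ∃ s : ℤ, 0 ≤ s ∧ s + q ≤ k * P + 1 ∧ ∀ j : Fin q, g (s + (j.1 : ℤ)) = vbar j)

theorem periodic_mul {x : ℤ → A} {P : ℤ} (hper : ∀ i, x (i + P) = x i) (k i : ℤ) :
    x (i + k * P) = x i := by
  have h : Function.Periodic x P := hper
  simpa using h.int_mul k i

theorem PRel.comp {T : A → A → Prop} {Φ : A → B} {x : ℤ → A} {P : ℤ} {q : ℕ}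
    {vbar : Fin q → A} (hP : 0 < P) (hper : ∀ i, x (i + P) = x i)
    {β β' : Prop} {k k' n : ℤ} {b c d : A} (hk : 0 ≤ k) (hk' : 0 ≤ k') (hn : n = k + k')
    (h : PRel T Φ x P vbar β k b c) (h' : PRel T Φ x P vbar β' k' c d) :
    PRel T Φ x P vbar (β ∨ β') n b d := by
  obtain ⟨g, hg, g0, g1, gΦ, gv⟩ := h
  obtain ⟨g', hg', g0', g1', gΦ', gv'⟩ := h'
  subst hn
  have kP : 0 ≤ k * P := by positivity
  have kP' : 0 ≤ k' * P := by positivity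
  have hs := pathSet_shift hg' (-(k * P))
  have key : ∀ i, k * P ≤ i →
      (if i ≤ k * P then g i else g' (i + -(k * P))) = g' (i - k * P) := by
    intro i hi
    split_ifs with h1
    · have : i = k * P := by omega
      subst this
      simp [g1, g0']
    · rfl
  refine ⟨_, pathSet_splice hg hs (k * P) (by simp [g1, g0']), ?_, ?_, ?_, ?_⟩
  · simp [kP, g0]
  · rw [key _ (by rw [add_mul]; omega), ← g1']
    congr 1; ring
  · intro i h0 h1
    by_cases h2 : i ≤ k * P
    · simp only [h2, if_true]
      exact gΦ i h0 h2
    · rw [key i (by omega), gΦ' _ (by omega) (by rw [add_mul] at h1; omega)]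
      rw [← periodic_mul hper k (i - k * P)]
      congr 2; ring
  · rintro (hb | hb)
    · obtain ⟨s, s0, s1, sv⟩ := gv hb
      refine ⟨s, s0, by rw [add_mul]; omega, fun j => ?_⟩
      have := j.2
      have h2 : s + (j.1 : ℤ) ≤ k * P := by omega
      simp only [h2, if_true]
      exact sv j
    · obtain ⟨s, s0, s1, sv⟩ := gv' hb
      refine ⟨s + k * P, by omega, by rw [add_mul]; omega, fun j => ?_⟩
      rw [key _ (by omega), ← sv j]
      congr 1; ring

/-- Restricting a path to `[mP, nP]`. -/
theorem PRel.of_path {T : A → A → Prop} {Φ : A → B} {x : ℤ → A} {P : ℤ} {q : ℕ}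
    (vbar : Fin q → A) (hper : ∀ i, x (i + P) = x i) {z : ℤ → A}
    (hz : z ∈ PathSet T) (m n : ℤ)
    (hΦ : ∀ i, m * P ≤ i → i ≤ n * P → Φ (z i) = Φ (x i)) :
    PRel T Φ x P vbar False (n - m) (z (m * P)) (z (n * P)) := by
  refine ⟨_, pathSet_shift hz (m * P), by simp, ?_, ?_, fun h => h.elim⟩
  · try dsimp only
    congr 1; ring
  · intro i h0 h1
    try dsimp only
    rw [hΦ _ (by omega) (by rw [sub_mul] at h1; omega), periodic_mul hper]

/-- Inserting a path into `z` between `mP` and `nP`. -/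
theorem PRel.insert {T : A → A → Prop} {Φ : A → B} {x : ℤ → A} {P : ℤ} {q : ℕ}
    {vbar : Fin q → A} (hP : 0 < P) (hper : ∀ i, x (i + P) = x i) {z : ℤ → A}
    (hz : z ∈ PathSet T) {m n : ℤ} (hmn : m ≤ n)
    (hΦ : ∀ i, m * P ≤ i → i ≤ n * P → Φ (z i) = Φ (x i)) {β : Prop}
    (h : PRel T Φ x P vbar β (n - m) (z (m * P)) (z (n * P))) :
    ∃ w ∈ PathSet T, (∀ i, i ≤ m * P → w i = z i) ∧ (∀ i, n * P ≤ i → w i = z i) ∧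
      (∀ i, Φ (w i) = Φ (z i)) ∧
      (β → ∃ s : ℤ, m * P ≤ s ∧ s + q ≤ n * P + 1 ∧
        ∀ j : Fin q, w (s + (j.1 : ℤ)) = vbar j) := by
  obtain ⟨g, hg, g0, g1, gΦ, gv⟩ := h
  have hmP : m * P ≤ n * P := by gcongr
  have hs := pathSet_shift hg (-(m * P))
  rw [sub_mul] at g1 gΦ gv
  have e1 : (fun i => g (i + -(m * P))) (n * P) = z (n * P) := by
    try dsimp only
    rw [← g1]; rfl
  have h1 := pathSet_splice hs hz (n * P) e1
  have e2 : z (m * P) =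
      (fun i => if i ≤ n * P then (fun i => g (i + -(m * P))) i else z i) (m * P) := by
    simp [hmP, g0]
  have h2 := pathSet_splice hz h1 (m * P) e2
  have key : ∀ i, m * P ≤ i → i ≤ n * P →
      (if i ≤ m * P then z i else if i ≤ n * P then g (i + -(m * P)) else z i)
        = g (i - m * P) := by
    intro i hi hi'
    split_ifs with h3
    · have : i = m * P := by omega
      subst this
      simp [g0]
    · rfl
  refine ⟨_, h2, ?_, ?_, ?_, ?_⟩
  · intro i hi
    simp [hi]
  · intro i hi
    try dsimp only
    split_ifs with h3 h4
    · rfl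
    · have : i = n * P := by omega
      subst this
      exact e1
    · rfl
  · intro i
    by_cases h3 : m * P ≤ i ∧ i ≤ n * P
    · try dsimp only
      rw [key i h3.1 h3.2, gΦ _ (by omega) (by omega), hΦ i h3.1 h3.2,
        ← periodic_mul hper m (i - m * P)]
      congr 2; ring
    · try dsimp only
      split_ifs with h4 h5
      · rfl
      · omega
      · rfl
  · intro hb
    obtain ⟨s, s0, s1, sv⟩ := gv hb
    refine ⟨s + m * P, by omega, by omega, fun j => ?_⟩
    have := j.2
    try dsimp only
    rw [key _ (by omega) (by omega), ← sv j]
    congr 1; ring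

/-- Every point of `Xbar` over the word of `x0` on `[l, r]` can be rerouted
through `M` at time `0`. -/
def Tr (T : A → A → Prop) (Φ : A → B) (Xbar : Set (ℤ → A)) (M : Set A) : Prop :=
  ∃ x0 ∈ PathSet T, ∃ l r : ℤ, l ≤ 0 ∧ 0 ≤ r ∧
    ∀ z ∈ Xbar, (∀ i, l ≤ i → i ≤ r → Φ (z i) = Φ (x0 i)) →
      ∃ z' ∈ PathSet T, (∀ i, i ≤ l → z' i = z i) ∧ (∀ i, r ≤ i → z' i = z i) ∧
        (∀ i, Φ (z' i) = Φ (z i)) ∧ z' 0 ∈ M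

/-- There is no diamond. -/
def NoDia (T : A → A → Prop) (Φ : A → B) (Xbar : Set (ℤ → A)) {q : ℕ}
    (vbar : Fin q → A) : Prop :=
  ∀ z ∈ Xbar, ∀ h ∈ PathSet T, ∀ lo hi : ℤ, lo ≤ hi → h lo = z lo → h hi = z hi →
    (∀ i, Φ (h i) = Φ (z i)) → ∀ s : ℤ, lo ≤ s → s + q ≤ hi + 1 →
    (∀ j : Fin q, h (s + (j.1 : ℤ)) = vbar j) → False

theorem pathSet_periodize {T : A → A → Prop} {x : ℤ → A} (hx : x ∈ PathSet T) {P : ℤ}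
    (hP : 0 < P) (h : x 0 = x P) : (fun i => x (i % P)) ∈ PathSet T := by
  intro i
  have h0 := Int.emod_nonneg i hP.ne'
  have h1 := Int.emod_lt_of_pos i hP
  have h2 := hx (i % P)
  by_cases h3 : i % P + 1 = P
  · have : (i + 1) % P = 0 := by
      rw [← Int.emod_add_emod, h3, Int.emod_self]
    try dsimp only
    rw [h3] at h2
    rw [this, h]
    exact h2
  · have : (i + 1) % P = i % P + 1 := by
      rw [← Int.emod_add_emod]
      exact Int.emod_eq_of_lt (by omega) (by omega)
    try dsimp only
    rw [this]
    exact h2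

/-- A periodic point through a given block and `vbar`. -/
theorem exists_periodic [TopologicalSpace A] {T : A → A → Prop}
    (hirr : IrreducibleSubshift (PathSet T)) {q : ℕ} {vbar : Fin q → A}
    (hv : OccursIn vbar (PathSet T)) {x1 : ℤ → A} (hx1 : x1 ∈ PathSet T) {l r : ℤ}
    (hl : l ≤ 0) (hr : 0 ≤ r) :
    ∃ x ∈ PathSet T, ∃ P : ℤ, r + 1 ≤ P + l ∧ (∀ i, x (i + P) = x i) ∧
      (∀ i, l ≤ i → i ≤ r → x i = x1 i) ∧
      ∃ s : ℤ, 0 ≤ s ∧ s + q ≤ P ∧ ∀ j : Fin q, x (s + (j.1 : ℤ)) = vbar j := by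
  obtain ⟨n, hn⟩ : ∃ n : ℕ, (n : ℤ) = r - l + 1 := ⟨(r - l + 1).toNat, by omega⟩
  have hu : OccursIn (fun j : Fin n => x1 (l + (j.1 : ℤ))) (PathSet T) :=
    ⟨x1, hx1, l, fun j => rfl⟩
  obtain ⟨x2, hx2, i, k, hik, h2u, h2v⟩ := hirr n q _ vbar hu hv
  obtain ⟨n', hn'⟩ : ∃ n' : ℕ, (n' : ℤ) = k + q - i := ⟨(k + q - i).toNat, by omega⟩
  have hu' : OccursIn (fun j : Fin n' => x2 (i + (j.1 : ℤ))) (PathSet T) :=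
    ⟨x2, hx2, i, fun j => rfl⟩
  obtain ⟨x3, hx3, i', k', hik', h3u, h3v⟩ := hirr n' n _ _ hu' hu
  have hx4 := pathSet_shift hx3 (i' - l)
  set x4 : ℤ → A := fun j => x3 (j + (i' - l)) with hx4def
  have a1 : ∀ j, l ≤ j → j ≤ r → x4 j = x1 j := by
    intro j hj hj'
    have b1 := h2u ⟨(j - l).toNat, by omega⟩
    have b2 := h3u ⟨(j - l).toNat, by omega⟩
    have e : ((j - l).toNat : ℤ) = j - l := by omega
    simp only [e] at b1 b2
    rw [b1] at b2
    rw [hx4def]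
    try dsimp only
    rw [show j + (i' - l) = i' + (j - l) by ring, b2]
    congr 1; ring
  have a2 : ∀ j : Fin q, x4 (l + (k - i) + (j.1 : ℤ)) = vbar j := by
    intro j
    have := j.2
    have b2 := h3u ⟨(k - i + j.1).toNat, by omega⟩
    have e : ((k - i + j.1).toNat : ℤ) = k - i + j.1 := by omega
    simp only [e] at b2
    rw [hx4def, ← h2v j]
    try dsimp only
    rw [show l + (k - i) + (j.1 : ℤ) + (i' - l) = i' + (k - i + j.1) by ring, b2]
    congr 1; ring
  have a3 : ∀ j, l ≤ j → j ≤ r → x4 (j + (k' - i')) = x1 j := by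
    intro j hj hj'
    have b2 := h3v ⟨(j - l).toNat, by omega⟩
    have e : ((j - l).toNat : ℤ) = j - l := by omega
    simp only [e] at b2
    rw [hx4def]
    try dsimp only
    rw [show j + (k' - i') + (i' - l) = k' + (j - l) by ring, b2]
    congr 1; ring
  have hP : 0 < k' - i' := by omega
  have hwrap : x4 0 = x4 (k' - i') := by
    rw [a1 0 hl hr, ← a3 0 hl hr, zero_add]
  refine ⟨_, pathSet_periodize hx4 hP hwrap, k' - i', by omega, ?_, ?_,
    l + (k - i), by omega, by omega, ?_⟩
  · intro j
    simp
  · intro j hj hj'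
    try dsimp only
    by_cases h0 : 0 ≤ j
    · rw [Int.emod_eq_of_lt h0 (by omega)]
      exact a1 j hj hj'
    · have : j % (k' - i') = j + (k' - i') := by
        rw [← Int.add_emod_right]
        exact Int.emod_eq_of_lt (by omega) (by omega)
      rw [this]
      exact a3 j hj hj'
  · intro j
    have := j.2
    try dsimp only
    rw [Int.emod_eq_of_lt (by omega) (by omega)]
    exact a2 j

/-- Simultaneous rerouting. -/
theorem simul_reroute {T : A → A → Prop} {Φ : A → B} {z : ℤ → A}
    {P l r N : ℤ} {M : Set A} (hP : 0 < P) (hl : l ≤ 0) (hr : 0 ≤ r) (hPl : r + 1 ≤ P + l)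
    (f : ℤ → ℤ → A) (hf : ∀ t, f t ∈ PathSet T)
    (hfl : ∀ t i, i ≤ l + t * P → f t i = z i)
    (hfr : ∀ t i, r + t * P ≤ i → f t i = z i) (hfΦ : ∀ t i, Φ (f t i) = Φ (z i))
    (hfM : ∀ t, -N ≤ t → t ≤ N → f t (t * P) ∈ M)
    (hfz : ∀ t, ¬ (-N ≤ t ∧ t ≤ N) → f t = z) :
    ∃ z' ∈ PathSet T, (∀ i, i ≤ l - N * P → z' i = z i) ∧
      (∀ i, r + N * P ≤ i → z' i = z i) ∧
      (∀ i, Φ (z' i) = Φ (z i)) ∧ ∀ t, -N ≤ t → t ≤ N → z' (t * P) ∈ M := by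
  have bnd : ∀ i : ℤ, l + ((i - l) / P) * P ≤ i ∧ i < l + ((i - l) / P) * P + P := by
    intro i
    have h1 := Int.mul_ediv_add_emod (i - l) P
    have h2 := Int.emod_nonneg (i - l) hP.ne'
    have h3 := Int.emod_lt_of_pos (i - l) hP
    rw [mul_comm] at h1
    omega
  have uniq : ∀ i t : ℤ, l + t * P ≤ i → i < l + t * P + P → (i - l) / P = t := by
    intro i t h1 h2
    rw [Int.ediv_eq_iff_of_pos hP]
    constructor <;> nlinarith
  refine ⟨fun i => f ((i - l) / P) i, ?_, ?_, ?_, fun i => hfΦ _ i, ?_⟩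
  · intro i
    try dsimp only
    obtain ⟨h1, h2⟩ := bnd i
    set t := (i - l) / P with ht
    by_cases h3 : i + 1 < l + t * P + P
    · rw [uniq (i + 1) t (by omega) h3]
      exact hf t i
    · have h4 : i + 1 = l + (t + 1) * P := by rw [add_mul]; omega
      rw [uniq (i + 1) (t + 1) (by omega) (by omega), hfl (t + 1) (i + 1) (by omega),
        ← hfr t (i + 1) (by rw [add_mul] at h4; omega)]
      exact hf t i
  · intro i hi
    try dsimp only
    obtain ⟨h1, h2⟩ := bnd i
    by_cases h3 : -N ≤ (i - l) / P
    · apply hfl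
      have : -N * P ≤ (i - l) / P * P := by gcongr
      rw [neg_mul] at this
      omega
    · rw [hfz _ (fun h => h3 h.1)]
  · intro i hi
    try dsimp only
    obtain ⟨h1, h2⟩ := bnd i
    by_cases h3 : (i - l) / P ≤ N
    · apply hfr
      have : (i - l) / P * P ≤ N * P := by gcongr
      omega
    · rw [hfz _ (fun h => h3 h.2)]
  · intro t h1 h2
    try dsimp only
    rw [uniq (t * P) t (by omega) (by omega)]
    exact hfM t h1 h2

/-- Pigeonhole. -/
theorem pigeon [Fintype A] (s : ℤ → A) (c : ℤ) :
    ∃ i j : ℤ, c ≤ i ∧ i < j ∧ j ≤ c + Fintype.card A ∧ s i = s j := by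
  obtain ⟨a, b, hab, h⟩ := Fintype.exists_ne_map_eq_of_card_lt
    (fun t : Fin (Fintype.card A + 1) => s (c + (t.1 : ℤ))) (by simp)
  have ha := a.2
  have hb := b.2
  have hne : a.1 ≠ b.1 := fun h => hab (Fin.ext h)
  rcases lt_or_gt_of_ne hne with h1 | h1
  · exact ⟨_, _, by omega, by omega, by omega, h⟩
  · exact ⟨c + b.1, c + a.1, by omega, by omega, by omega, h.symm⟩

theorem Tr.step [Fintype A] [TopologicalSpace A] {T : A → A → Prop} {Φ : A → B}
    {Xbar : Set (ℤ → A)} (hXs : ∀ n : ℤ, ∀ x ∈ Xbar, shiftMap n x ∈ Xbar)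
    (hsub : Xbar ⊆ PathSet T)
    (hirr : IrreducibleSubshift (PathSet T)) {q : ℕ} {vbar : Fin q → A}
    (hv : OccursIn vbar (PathSet T)) (hND : NoDia T Φ Xbar vbar)
    {M : Set A} {a : A} (h : Tr T Φ Xbar (insert a M)) : Tr T Φ Xbar M := by
  obtain ⟨x0, hx0, l, r, hl, hr, H⟩ := h
  by_cases hex : ∃ x1 ∈ PathSet T, x1 0 = a ∧ ∀ i, l ≤ i → i ≤ r → Φ (x1 i) = Φ (x0 i)
  swap
  · refine ⟨x0, hx0, l, r, hl, hr, fun z hz hzΦ => ?_⟩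
    obtain ⟨z', hz', h1, h2, h3, h4⟩ := H z hz hzΦ
    refine ⟨z', hz', h1, h2, h3, ?_⟩
    rcases h4 with h4 | h4
    · exact absurd ⟨z', hz', h4, fun i hi hi' => (h3 i).trans (hzΦ i hi hi')⟩ hex
    · exact h4
  obtain ⟨x1, hx1, hx1a, hx1Φ⟩ := hex
  obtain ⟨x, hx, P, hPl, hper, hxx1, s0, hs0, hs0P, hs0v⟩ :=
    exists_periodic hirr hv hx1 hl hr
  have hP : 0 < P := by omega
  have hxa : x 0 = a := by rw [hxx1 0 hl hr, hx1a]
  set N : ℤ := Fintype.card A + 1 with hN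
  have hN0 : 0 < N := by omega
  have hNP : 0 < N * P := by positivity
  refine ⟨x, hx, l - N * P, r + N * P, by omega, by omega, fun z hz hzΦ => ?_⟩
  have reroute_at : ∀ t : ℤ, ∃ g ∈ PathSet T, (∀ i, i ≤ l + t * P → g i = z i) ∧
      (∀ i, r + t * P ≤ i → g i = z i) ∧ (∀ i, Φ (g i) = Φ (z i)) ∧
      (-N ≤ t → t ≤ N → g (t * P) ∈ insert a M) ∧ (¬ (-N ≤ t ∧ t ≤ N) → g = z) := by
    intro t
    by_cases ht : -N ≤ t ∧ t ≤ N
    · have u1 : -N * P ≤ t * P := by have := ht.1; gcongr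
      have u2 : t * P ≤ N * P := by have := ht.2; gcongr
      rw [neg_mul] at u1
      obtain ⟨g, hg, g1, g2, g3, g4⟩ := H (shiftMap (t * P) z) (hXs _ z hz) (by
        intro i hi hi'
        unfold shiftMap
        rw [hzΦ _ (by omega) (by omega), periodic_mul hper, hxx1 i hi hi', hx1Φ i hi hi'])
      refine ⟨_, pathSet_shift hg (-(t * P)), ?_, ?_, ?_, ?_, fun h => absurd ht h⟩
      · intro i hi
        try dsimp only
        rw [g1 _ (by omega)]
        simp [shiftMap]
      · intro i hi
        try dsimp only
        rw [g2 _ (by omega)]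
        simp [shiftMap]
      · intro i
        try dsimp only
        rw [g3]
        simp [shiftMap]
      · intro _ _
        simpa using g4
    · exact ⟨z, hsub hz, fun _ _ => rfl, fun _ _ => rfl, fun _ => rfl,
        fun h1 h2 => absurd ⟨h1, h2⟩ ht, fun _ => rfl⟩
  choose f hf hfl hfr hfΦ hfM hfz using reroute_at
  obtain ⟨z', hz', z1, z2, z3, z4⟩ := simul_reroute (Φ := Φ) hP hl hr hPl f hf hfl hfr hfΦ hfM hfz
  have z'Φ : ∀ i, l - N * P ≤ i → i ≤ r + N * P → Φ (z' i) = Φ (x i) :=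
    fun i hi hi' => (z3 i).trans (hzΦ i hi hi')
  by_cases hza : z' 0 = a
  swap
  · refine ⟨z', hz', z1, z2, z3, ?_⟩
    have := z4 0 (by omega) (by omega)
    rw [zero_mul] at this
    exact this.resolve_left hza
  set s : ℤ → A := fun t => z' (t * P) with hs
  have hsa : s 0 = a := by simp [hs, hza]
  have mono : ∀ m n : ℤ, m ≤ n → m * P ≤ n * P := fun m n h => by gcongr
  have bd : ∀ m : ℤ, -N ≤ m → -(N * P) ≤ m * P := fun m h => by
    have := mono _ _ h
    rwa [neg_mul] at this
  have seg : ∀ m n : ℤ, -N ≤ m → n ≤ N → ∀ i, m * P ≤ i → i ≤ n * P →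
      Φ (z' i) = Φ (x i) := by
    intro m n hm hn i hi hi'
    have := bd m hm
    have := mono n N hn
    exact z'Φ i (by omega) (by omega)
  have R : ∀ m n : ℤ, -N ≤ m → n ≤ N →
      PRel T Φ x P vbar False (n - m) (s m) (s n) := fun m n hm hn =>
    PRel.of_path vbar hper hz' m n (seg m n hm hn)
  have xm : ∀ k : ℤ, x (k * P) = a := fun k => by
    rw [← zero_add (k * P), periodic_mul hper, hxa]
  have La : ∀ k : ℤ, PRel T Φ x P vbar False k a a := by
    intro k
    exact ⟨x, hx, hxa, xm k, fun _ _ _ => rfl, fun h => h.elim⟩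
  have Va : ∀ k : ℤ, 1 ≤ k → PRel T Φ x P vbar True k a a := by
    intro k hk
    have := mono 1 k hk
    exact ⟨x, hx, hxa, xm k, fun _ _ _ => rfl, fun _ => ⟨s0, hs0, by omega, hs0v⟩⟩
  have noV : ∀ m n : ℤ, -N ≤ m → m ≤ n → n ≤ N →
      ¬ PRel T Φ x P vbar True (n - m) (s m) (s n) := by
    intro m n hm hmn hn hV
    obtain ⟨w, hw, w1, w2, w3, w4⟩ := PRel.insert hP hper hz' hmn (seg m n hm hn) hV
    obtain ⟨σ, σ0, σ1, σv⟩ := w4 trivial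
    have b1 := bd m hm
    have b2 := mono n N hn
    exact hND z hz w hw (l - N * P) (r + N * P) (by omega)
      ((w1 _ (by omega)).trans (z1 _ le_rfl)) ((w2 _ (by omega)).trans (z2 _ le_rfl))
      (fun i => (w3 i).trans (z3 i)) σ (by omega) (by omega) σv
  have sne : ∀ t : ℤ, -N ≤ t → t ≤ N → t ≠ 0 → s t ≠ a := by
    intro t h1 h2 h3 h4
    rcases lt_or_gt_of_ne h3 with h5 | h5
    · apply noV t 0 h1 (by omega) (by omega)
      rw [h4, hsa]
      exact Va _ (by omega)
    · apply noV 0 t (by omega) (by omega) h2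
      rw [h4, hsa]
      exact Va _ (by omega)
  have sM : ∀ t : ℤ, -N ≤ t → t ≤ N → t ≠ 0 → s t ∈ M := fun t h1 h2 h3 =>
    (z4 t h1 h2).resolve_left (sne t h1 h2 h3)
  have fin : ∀ m n : ℤ, ∀ e : A, -N ≤ m → m ≤ 0 → 0 ≤ n → n ≤ N → e ∈ M →
      PRel T Φ x P vbar False (0 - m) (s m) e → PRel T Φ x P vbar False (n - 0) e (s n) →
      ∃ z' ∈ PathSet T, (∀ i, i ≤ l - N * P → z' i = z i) ∧
        (∀ i, r + N * P ≤ i → z' i = z i) ∧ (∀ i, Φ (z' i) = Φ (z i)) ∧ z' 0 ∈ M := by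
    intro m n e hm hm0 hn0 hn he h1 h2
    obtain ⟨g, hg, g0, g1, gΦ, -⟩ := h1
    obtain ⟨g', hg', g0', g1', gΦ', -⟩ := h2
    have b1 := bd m hm
    have b2 := mono n N hn
    have b3 := mono m 0 hm0
    have b4 := mono 0 n hn0
    rw [zero_mul] at b3 b4
    simp only [zero_sub, sub_zero, neg_mul] at g1 gΦ g1' gΦ'
    have k1 := pathSet_splice hz' (pathSet_shift hg (-(m * P))) (m * P) (by simp [g0, hs])
    have k2 := pathSet_splice hg' hz' (n * P) (by simp [g1', hs])
    have k3 := pathSet_splice k1 k2 0 (by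
      try dsimp only
      rw [if_pos b4, g0']
      split_ifs with h5
      · have h6 : m * P = 0 := by omega
        have : z' 0 = s m := by simp [hs, h6]
        rw [this, ← g0, ← g1, h6, neg_zero]
      · rw [zero_add, g1])
    refine ⟨_, k3, ?_, ?_, ?_, ?_⟩
    · intro i hi
      have q1 : i ≤ 0 := by omega
      have q2 : i ≤ m * P := by omega
      simp only [q1, q2, if_true]
      exact z1 i hi
    · intro i hi
      have q1 : ¬ i ≤ 0 := by omega
      simp only [q1, if_false]
      split_ifs with q2
      · have q3 : i = n * P := by omega
        rw [q3, g1']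
        exact z2 (n * P) (by omega)
      · exact z2 i hi
    · intro i
      try dsimp only
      split_ifs with q1 q2 q2
      · exact z3 i
      · rw [gΦ _ (by omega) (by omega), hzΦ i (by omega) (by omega),
          ← neg_mul, periodic_mul hper]
      · rw [gΦ' _ (by omega) (by omega), hzΦ i (by omega) (by omega)]
      · exact z3 i
    · try dsimp only
      rw [if_pos le_rfl]
      split_ifs with h5
      · have h6 : m * P = 0 := by omega
        have : z' 0 = s m := by simp [hs, h6]
        rw [this, ← g0]
        rw [h6, neg_zero] at g1
        rw [g1]; exact he
      · rw [zero_add, g1]; exact he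
  obtain ⟨i, j, hi, hij, hj, hsij⟩ := pigeon s (-N)
  obtain ⟨k, k', hk, hkk, hk', hskk⟩ := pigeon s 1
  have i1 : -N ≤ i := hi
  have j1 : j ≤ -1 := by omega
  have k1 : k' ≤ N := by omega
  rcases le_total (k' - k) (j - i) with hc | hc
  · refine fin i k (s (k' - k)) i1 (by omega) (by omega) (by omega)
      (sM _ (by omega) (by omega) (by omega)) ?_ ?_
    · have p1 := R j 0 (by omega) (by omega)
      rw [← hsij, hsa] at p1
      have p2 := La ((j - i) - (k' - k))
      have p3 := R 0 (k' - k) (by omega) (by omega)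
      rw [hsa] at p3
      have p4 := PRel.comp hP hper (by omega) (by omega) rfl p1 p2
      have p5 := PRel.comp hP hper (n := 0 - i) (by omega) (by omega) (by ring) p4 p3
      simpa using p5
    · have p1 := R (k' - k) k' (by omega) (by omega)
      rw [← hskk] at p1
      have e : k' - (k' - k) = k - 0 := by ring
      rw [e] at p1
      exact p1
  · refine fin j k' (s (-(j - i))) (by omega) (by omega) (by omega) (by omega)
      (sM _ (by omega) (by omega) (by omega)) ?_ ?_
    · have p1 := R i (-(j - i)) (by omega) (by omega)
      rw [hsij] at p1
      have e : -(j - i) - i = 0 - j := by ring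
      rw [e] at p1
      exact p1
    · have p1 := R (-(j - i)) 0 (by omega) (by omega)
      rw [hsa] at p1
      have p2 := La ((k' - k) - (j - i))
      have p3 := R 0 k (by omega) (by omega)
      rw [hsa, hskk] at p3
      have p4 := PRel.comp hP hper (by omega) (by omega) rfl p1 p2
      have p5 := PRel.comp hP hper (n := k' - 0) (by omega) (by omega) (by ring) p4 p3
      simpa using p5

theorem exists_diamond [Fintype A] [TopologicalSpace A] [DiscreteTopology A]
    [Fintype B] [TopologicalSpace B] [DiscreteTopology B]
    (X Xbar : Set (ℤ → A)) (Y : Set (ℤ → B)) (π : (ℤ → A) → ℤ → B) (Φ : A → B)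
    (hT : FactorTriple X Y π) (hXirr : IrreducibleSubshift X) (hX1 : IsOneStep X)
    (hΦ : OneBlockRule π Φ)
    (hXbar : IsSubshift Xbar) (hsub : Xbar ⊆ X) (hproper : Xbar ≠ X)
    (honto : π '' Xbar = Y)
    (q : ℕ) (vbar : Fin q → A) (hv1 : OccursIn vbar X) (hv2 : ¬ OccursIn vbar Xbar) :
    ∃ (p : ℕ) (u v : Fin (p + 1) → A), IsDiamond X Xbar Φ vbar u v := by
  by_contra hno
  obtain ⟨hXs, T, hXT⟩ := hX1
  have hXT' : X = PathSet T := hXT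
  subst hXT'
  clear hXT
  have hND : NoDia T Φ Xbar vbar := by
    intro z hz h hh lo hi hlh h1 h2 h3 s hs1 hs2 hsv
    apply hno
    refine ⟨(hi - lo).toNat, fun j => z (lo + (j.1 : ℤ)), fun j => h (lo + (j.1 : ℤ)),
      ⟨z, hz, lo, fun _ => rfl⟩, ⟨h, hh, lo, fun _ => rfl⟩, fun j => (h3 _).symm,
      ⟨(s - lo).toNat, by omega, fun j => ?_⟩, ?_, ?_⟩
    · rw [← hsv j]
      try dsimp only
      congr 1
      omega
    · simp [h1]
    · have e : lo + ((hi - lo).toNat : ℤ) = hi := by omega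
      simp only [Fin.val_last, e, h2]
  have main : ∀ M : Finset A, ¬ Tr T Φ Xbar (M : Set A) := by
    intro M
    classical
    induction M using Finset.induction_on with
    | empty =>
      rintro ⟨x0, hx0, l, r, hl, hr, H⟩
      have hy : π x0 ∈ π '' Xbar := by
        rw [honto]
        exact hT.2.2.2.1 x0 hx0
      obtain ⟨z, hz, hzx⟩ := hy
      obtain ⟨z', -, -, -, -, h⟩ := H z hz (fun i _ _ => by rw [← hΦ, ← hΦ, hzx])
      simp at h
    | insert a M _ ih =>
      intro h
      rw [Finset.coe_insert] at h
      exact ih (Tr.step hXbar.2 hsub hXirr hv1 hND h)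
  obtain ⟨x0, hx0, -⟩ := hv1
  apply main Finset.univ
  exact ⟨x0, hx0, 0, 0, le_rfl, le_rfl, fun z hz _ =>
    ⟨z, hsub hz, fun _ _ => rfl, fun _ _ => rfl, fun _ => rfl, by simp⟩⟩
end

section
/- Let (X, Y, π) be an irreducible factor triple and y ∈ Y a right transitive point. Then each transition class over y contains a right transitive point of X. -/
open Set

universe u v uc

variable {A : Type u} {B : Type v}

/-- `n`-fold repetition of the word `V`. -/
def wpow {B : Type*} (V : List B) (n : ℕ) : List B := (List.replicate n V).flatten

theorem wpow_add {B : Type*} (V : List B) (m n : ℕ) : wpow V (m + n) = wpow V m ++ wpow V n := by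
  simp only [wpow, List.replicate_add, List.flatten_append]

theorem wpow_one {B : Type*} (V : List B) : wpow V 1 = V := by simp [wpow]

theorem exists_rel_idem {S B : Type*} [Finite S] (R : List B → S → S → Prop)
    (hR : ∀ u w a c, R (u ++ w) a c ↔ ∃ b, R u a b ∧ R w b c) (V : List B) :
    ∃ p, R (wpow V ((p + 1) + (p + 1))) = R (wpow V (p + 1)) := by
  have comp : ∀ i j m, R (wpow V i) = R (wpow V j) →
      R (wpow V (i + m)) = R (wpow V (j + m)) := by
    intro i j m h
    funext a c
    simp only [wpow_add, hR, h]
  obtain ⟨i, j, hne, hij⟩ := Finite.exists_ne_map_eq_of_infinite (fun n => R (wpow V n))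
  wlog hlt : i < j generalizing i j
  · exact this j i hne.symm hij.symm (by omega)
  obtain ⟨k, rfl⟩ : ∃ k, j = i + (k + 1) := ⟨j - i - 1, by omega⟩
  have h1 : ∀ m, R (wpow V (i + m + (k + 1))) = R (wpow V (i + m)) := by
    intro m
    have := comp _ _ m hij
    rw [show i + m + (k + 1) = i + (k + 1) + m by omega]
    exact this.symm
  have h2 : ∀ t m, R (wpow V (i + m + t * (k + 1))) = R (wpow V (i + m)) := by
    intro t
    induction t with
    | zero => simp
    | succ t ih =>
      intro m
      rw [← ih m]
      have := h1 (m + t * (k + 1))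
      convert this using 3 <;> ring
  refine ⟨i * (k + 1) + k, ?_⟩
  have := h2 (i + 1) (i * k + k + 1)
  convert this using 3 <;> ring

theorem core {S B : Type*} [Finite S] (R Rv : List B → S → S → Prop)
    (hR : ∀ u w a c, R (u ++ w) a c ↔ ∃ b, R u a b ∧ R w b c)
    (hle : ∀ w a b, Rv w a b → R w a b)
    (hl : ∀ u w a b c, Rv u a b → R w b c → Rv (u ++ w) a c)
    (hr : ∀ u w a b c, R u a b → Rv w b c → Rv (u ++ w) a c)
    (hirr : ∀ w w' a b c d, R w a b → R w' c d → ∃ U, R U b c)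
    (hv : ∃ w a b, Rv w a b) :
    ∃ W, (∃ a b, R W a b) ∧ ∀ a b, R W a b → Rv W a b := by
  classical
  have := Fintype.ofFinite S
  have key : ∀ (M : Finset S) (W₁ W₂ : List B), (∃ a b, R (W₁ ++ W₂) a b) →
      (∀ a b, R (W₁ ++ W₂) a b → Rv (W₁ ++ W₂) a b ∨ ∃ m ∈ M, R W₁ a m ∧ R W₂ m b) →
      ∃ W, (∃ a b, R W a b) ∧ ∀ a b, R W a b → Rv W a b := by
    intro M
    induction M using Finset.induction_on with
    | empty =>
      intro W₁ W₂ h1 h2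
      refine ⟨_, h1, fun a b hab => ?_⟩
      simpa using h2 a b hab
    | insert c M hc ih =>
      intro W₁ W₂ h1 h2
      by_cases hex : ∃ a b, R W₁ a c ∧ R W₂ c b
      · obtain ⟨a, b, hac, hcb⟩ := hex
        obtain ⟨w0, a0, b0, hv0⟩ := hv
        obtain ⟨U1, hU1⟩ := hirr _ _ _ _ _ _ hcb (hle _ _ _ hv0)
        obtain ⟨U2, hU2⟩ := hirr _ _ _ _ _ _ (hle _ _ _ hv0) hac
        obtain ⟨U, hU⟩ : ∃ U, Rv U b a := ⟨U1 ++ (w0 ++ U2), hr _ _ _ _ _ hU1 (hl _ _ _ _ _ hv0 hU2)⟩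
        set V := W₂ ++ (U ++ W₁) with hV
        have hVc : Rv V c c := hr _ _ _ _ _ hcb (hl _ _ _ _ _ hU hac)
        obtain ⟨p, hp⟩ := exists_rel_idem R hR V
        have hpow : ∀ n, Rv (wpow V (n + 1)) c c := by
          intro n
          induction n with
          | zero => simpa [wpow_one] using hVc
          | succ n ihn =>
            rw [wpow_add, wpow_one]
            exact hl _ _ _ _ _ ihn (hle _ _ _ hVc)
        apply ih (W₁ ++ wpow V (p + 1)) (wpow V ((p + 1) + (p + 1)) ++ W₂)
        · refine ⟨a, b, ?_⟩
          rw [hR]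
          refine ⟨c, (hR _ _ _ _).2 ⟨c, hac, hle _ _ _ (hpow _)⟩, (hR _ _ _ _).2 ⟨c, hle _ _ _ (hpow _), hcb⟩⟩
        · intro a' b' hab
          have e1 : W₁ ++ wpow V (p + 1) = (W₁ ++ wpow V p ++ W₂ ++ U) ++ W₁ := by
            rw [wpow_add, wpow_one, hV]; simp
          have e2 : wpow V ((p + 1) + (p + 1)) ++ W₂ =
              W₂ ++ (U ++ W₁ ++ wpow V (p + (p + 1)) ++ W₂) := by
            rw [show (p + 1) + (p + 1) = 1 + (p + (p + 1)) by ring, wpow_add, wpow_one, hV]; simp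
          have e3 : (W₁ ++ wpow V (p + 1)) ++ (wpow V ((p + 1) + (p + 1)) ++ W₂) =
              (W₁ ++ wpow V p ++ W₂ ++ U) ++
                ((W₁ ++ W₂) ++ (U ++ W₁ ++ wpow V (p + (p + 1)) ++ W₂)) := by
            rw [e1, e2]; simp only [List.append_assoc]
          have hab' := hab
          rw [e3, hR] at hab'
          obtain ⟨x, hx1, hx2⟩ := hab'
          rw [hR] at hx2
          obtain ⟨x', hx3, hx4⟩ := hx2
          rcases h2 _ _ hx3 with h | ⟨m, hm, hm1, hm2⟩
          · left
            rw [e3]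
            exact hr _ _ _ _ _ hx1 (hl _ _ _ _ _ h hx4)
          · have f1 : R (W₁ ++ wpow V (p + 1)) a' m := by
              rw [e1]; exact (hR _ _ _ _).2 ⟨x, hx1, hm1⟩
            have f2 : R (wpow V ((p + 1) + (p + 1)) ++ W₂) m b' := by
              rw [e2]; exact (hR _ _ _ _).2 ⟨x', hm2, hx4⟩
            rcases Finset.mem_insert.1 hm with rfl | hm
            · left
              obtain ⟨m3, g1, g2⟩ := (hR _ _ _ _).1 f2
              rw [hp] at g1
              apply hr _ _ _ _ _ f1
              apply hl _ _ _ _ _ _ g2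
              rw [wpow_add]
              exact hl _ _ _ _ _ (hpow p) g1
            · exact Or.inr ⟨m, hm, f1, f2⟩
      · refine ih W₁ W₂ h1 fun a b hab => ?_
        rcases h2 a b hab with h | ⟨m, hm, hm1, hm2⟩
        · exact Or.inl h
        · rcases Finset.mem_insert.1 hm with rfl | hm
          · exact absurd ⟨a, b, hm1, hm2⟩ hex
          · exact Or.inr ⟨m, hm, hm1, hm2⟩
  obtain ⟨w, a, b, hw⟩ := hv
  refine key Finset.univ w [] ⟨a, b, by simpa using hle _ _ _ hw⟩ fun a b hab => Or.inr ?_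
  obtain ⟨m, h1, h2⟩ := (hR _ _ _ _).1 hab
  exact ⟨m, Finset.mem_univ _, h1, h2⟩

/-- The state of `x` at time `i`: the window `[i - L, i + L)`. -/
def st {A : Type*} (L : ℕ) (x : ℤ → A) (i : ℤ) : Fin (2 * L) → A := fun j => x (i - L + (j.1 : ℤ))

theorem st_eq {A : Type*} {L : ℕ} {x z : ℤ → A} {i k : ℤ} (h : st L x i = st L z k) (d : ℤ)
    (h1 : -(L : ℤ) ≤ d) (h2 : d < L) : x (i + d) = z (k + d) := by
  have := congrFun h ⟨(d + L).toNat, by omega⟩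
  simp only [st] at this
  rwa [Int.toNat_of_nonneg (by omega), show i - L + (d + L) = i + d by ring,
    show k - L + (d + L) = k + d by ring] at this

theorem st_congr {A : Type*} {L : ℕ} {x z : ℤ → A} {i k : ℤ}
    (h : ∀ d : ℤ, -(L : ℤ) ≤ d → d < L → x (i + d) = z (k + d)) : st L x i = st L z k := by
  funext j
  have := h (j.1 - L) (by omega) (by have := j.2; omega)
  simp only [st]
  rwa [show i - L + (j.1 : ℤ) = i + (j.1 - L) by ring, show k - L + (j.1 : ℤ) = k + (j.1 - L) by ring]

/-- Splicing property with radius `L`. -/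
def Splices {A B : Type*} (X : Set (ℤ → A)) (π : (ℤ → A) → ℤ → B) (L : ℕ) : Prop :=
  ∀ x ∈ X, ∀ z ∈ X, ∀ i : ℤ, (∀ j, i - L ≤ j → j < i + L → x j = z j) →
    ∃ s ∈ X, (∀ j, j < i + L → s j = x j) ∧ (∀ j, i - L ≤ j → s j = z j) ∧
      (∀ j, j < i → π s j = π x j) ∧ (∀ j, i ≤ j → π s j = π z j)

/-- `w` labels a path from state `a` to state `b` realised by `x`. -/
def PathOf {A B : Type*} (X : Set (ℤ → A)) (π : (ℤ → A) → ℤ → B) (L : ℕ) (w : List B)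
    (a b : Fin (2 * L) → A) (x : ℤ → A) : Prop :=
  x ∈ X ∧ st L x 0 = a ∧ st L x w.length = b ∧ ∀ j : ℕ, j < w.length → w[j]? = some (π x j)

theorem pathOf_glue {A B : Type*} {X : Set (ℤ → A)} {π : (ℤ → A) → ℤ → B} {L : ℕ}
    (hs : Splices X π L) (hX : ∀ n : ℤ, ∀ x ∈ X, shiftMap n x ∈ X)
    (hπ : ∀ n x j, π (shiftMap n x) j = π x (j + n))
    {u w : List B} {a b c : Fin (2 * L) → A} {x z : ℤ → A}
    (h1 : PathOf X π L u a b x) (h2 : PathOf X π L w b c z) :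
    ∃ s, PathOf X π L (u ++ w) a c s ∧ (∀ j : ℤ, j < u.length + L → s j = x j) ∧
      (∀ j : ℤ, u.length - L ≤ j → s j = z (j - u.length)) := by
  obtain ⟨hx, ha, hb, hl⟩ := h1
  obtain ⟨hz, hb', hc, hl'⟩ := h2
  obtain ⟨s, hsX, s1, s2, s3, s4⟩ := hs x hx (shiftMap (-(u.length : ℤ)) z) (hX _ _ hz) u.length (by
    intro j h1 h2
    have := st_eq (hb.trans hb'.symm) (j - u.length) (by omega) (by omega)
    rw [show (u.length : ℤ) + (j - u.length) = j by ring] at this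
    rw [this, shiftMap]; congr 1; ring)
  refine ⟨s, ⟨hsX, ?_, ?_, ?_⟩, s1, fun j hj => s2 j hj⟩
  · rw [← ha]
    apply st_congr
    intro d h1 h2
    apply s1; omega
  · rw [← hc]
    apply st_congr
    intro d h1 h2
    rw [s2 _ (by simp; omega), shiftMap]
    congr 1; simp; ring
  · intro j hj
    rw [List.getElem?_append]
    split_ifs with h
    · rw [hl j h, s3 _ (by omega)]
    · rw [List.length_append] at hj
      rw [hl' _ (by omega), s4 _ (by omega), hπ]
      congr 2; omega

theorem pathOf_split {A B : Type*} {X : Set (ℤ → A)} {π : (ℤ → A) → ℤ → B} {L : ℕ}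
    (hX : ∀ n : ℤ, ∀ x ∈ X, shiftMap n x ∈ X)
    (hπ : ∀ n x j, π (shiftMap n x) j = π x (j + n))
    {u w : List B} {a c : Fin (2 * L) → A} {x : ℤ → A}
    (h : PathOf X π L (u ++ w) a c x) :
    PathOf X π L u a (st L x u.length) x ∧
      PathOf X π L w (st L x u.length) c (shiftMap u.length x) := by
  obtain ⟨hx, ha, hc, hl⟩ := h
  refine ⟨⟨hx, ha, rfl, ?_⟩, hX _ _ hx, ?_, ?_, ?_⟩
  · intro j hj
    rw [← hl j (by simp; omega), List.getElem?_append_left hj]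
  · apply st_congr
    intro d _ _
    simp only [shiftMap]; congr 1; ring
  · rw [← hc]
    apply st_congr
    intro d _ _
    simp only [shiftMap]; congr 1; simp; ring
  · intro j hj
    have := hl (u.length + j) (by simp; omega)
    rw [List.getElem?_append_right (by omega)] at this
    rw [hπ, show u.length + j - u.length = j by omega] at *
    rw [this]; congr 2; push_cast; ring

/-- Every block of `X` admits a magic word over which it can always be inserted. -/
theorem exists_magic {A B : Type*} [Finite A] [TopologicalSpace A]
    {X : Set (ℤ → A)} {π : (ℤ → A) → ℤ → B} {L : ℕ}
    (hs : Splices X π L) (hX : ∀ n : ℤ, ∀ x ∈ X, shiftMap n x ∈ X)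
    (hπ : ∀ n x j, π (shiftMap n x) j = π x (j + n))
    (hirr : IrreducibleSubshift X) {p : ℕ} (v : Fin p → A) (hv : OccursIn v X) :
    ∃ W : List B, (∃ a b x, PathOf X π L W a b x) ∧ ∀ a b x, PathOf X π L W a b x →
      ∃ x', PathOf X π L W a b x' ∧ ∃ i : ℤ, 0 ≤ i ∧ i + p ≤ W.length ∧
        ∀ j : Fin p, x' (i + (j.1 : ℤ)) = v j := by
  have word : ∀ x ∈ X, ∀ (i : ℤ) (n : ℕ), PathOf X π L
      ((List.range n).map fun j : ℕ => π x (i + j)) (st L x i) (st L x (i + n)) (shiftMap i x) := by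
    intro x hx i n
    refine ⟨hX _ _ hx, ?_, ?_, ?_⟩
    · apply st_congr
      intro d _ _
      simp only [shiftMap]; congr 1; ring
    · apply st_congr
      intro d _ _
      simp only [shiftMap]; congr 1; simp; ring
    · intro j hj
      simp only [List.length_map, List.length_range] at hj
      simp [hj, hπ, add_comm]
  refine Exists.elim (core
    (fun w a b => ∃ x, PathOf X π L w a b x)
    (fun w a b => ∃ x', PathOf X π L w a b x' ∧ ∃ i : ℤ, 0 ≤ i ∧ i + p ≤ w.length ∧
        ∀ j : Fin p, x' (i + (j.1 : ℤ)) = v j) ?_ ?_ ?_ ?_ ?_ ?_)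
    (fun W ⟨hW1, hW⟩ => ⟨W, hW1, fun a b x h => hW a b ⟨x, h⟩⟩)
  · intro u w a c
    constructor
    · rintro ⟨x, hx⟩
      obtain ⟨h1, h2⟩ := pathOf_split hX hπ hx
      exact ⟨_, ⟨_, h1⟩, ⟨_, h2⟩⟩
    · rintro ⟨b, ⟨x, hx⟩, ⟨z, hz⟩⟩
      obtain ⟨s, h, _⟩ := pathOf_glue hs hX hπ hx hz
      exact ⟨s, h⟩
  · rintro w a b ⟨x, hx, _⟩
    exact ⟨x, hx⟩
  · rintro u w a b c ⟨x, hx, i, hi, hip, hj⟩ ⟨z, hz⟩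
    obtain ⟨s, h, h1, h2⟩ := pathOf_glue hs hX hπ hx hz
    refine ⟨s, h, i, hi, by simp; omega, fun j => ?_⟩
    rw [h1 _ (by have := j.2; omega), hj]
  · rintro u w a b c ⟨z, hz⟩ ⟨x, hx, i, hi, hip, hj⟩
    obtain ⟨s, h, h1, h2⟩ := pathOf_glue hs hX hπ hz hx
    refine ⟨s, h, u.length + i, by omega, by simp; omega, fun j => ?_⟩
    rw [h2 _ (by omega), ← hj]
    congr 1; ring
  · rintro w w' a b c d ⟨x, hx, -, hb, -⟩ ⟨z, hz, hc, -, -⟩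
    obtain ⟨s, hs, i, k, hik, h1, h2⟩ := hirr (2 * L) (2 * L) b c
      ⟨x, hx, w.length - L, fun j => by rw [← hb]; rfl⟩ ⟨z, hz, 0 - L, fun j => by rw [← hc]; rfl⟩
    have := word s hs (i + L) (k - i).toNat
    rw [Int.toNat_of_nonneg (by push_cast at hik; omega)] at this
    have e1 : st L s (i + L) = b := by
      funext j; rw [← h1 j, st]; congr 1; ring
    have e2 : st L s (i + L + (k - i)) = c := by
      funext j; rw [← h2 j, st]; congr 1; ring
    rw [e1, e2] at this
    exact ⟨_, _, this⟩
  · obtain ⟨x, hx, i, hj⟩ := hv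
    refine ⟨_, _, _, _, word x hx i p, 0, le_rfl, by simp, fun j => ?_⟩
    rw [← hj, shiftMap]; congr 1; ring

/-- One modification step. -/
theorem step {A B : Type*} [Finite A] [TopologicalSpace A]
    {X : Set (ℤ → A)} {Y : Set (ℤ → B)} {π : (ℤ → A) → ℤ → B} {L : ℕ}
    (hs : Splices X π L) (hX : ∀ n : ℤ, ∀ x ∈ X, shiftMap n x ∈ X)
    (hπ : ∀ n x j, π (shiftMap n x) j = π x (j + n)) (hXY : ∀ x ∈ X, π x ∈ Y)
    (hirr : IrreducibleSubshift X) {y : ℤ → B} (hy : RightTransitive Y y)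
    {p : ℕ} (v : Fin p → A) (hv : OccursIn v X) (x : ℤ → A) (hx : x ∈ X) (hxy : π x = y) (t : ℤ) :
    ∃ x' ∈ X, π x' = y ∧ (∀ j < t, x' j = x j) ∧ (∃ t', t ≤ t' ∧ ∀ j, t' ≤ j → x' j = x j) ∧
      ∃ i : ℤ, t ≤ i ∧ ∀ j : Fin p, x' (i + (j.1 : ℤ)) = v j := by
  obtain ⟨W, ⟨a, b, z, hz⟩, hW⟩ := exists_magic hs hX hπ hirr v hv
  obtain ⟨n, hn, hyn⟩ := hy.2 (π (shiftMap (-(t.toNat : ℤ)) z)) (hXY _ (hX _ _ hz.1))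
    (t.toNat + W.length)
  obtain ⟨q, hqt, hq⟩ : ∃ q : ℤ, t ≤ q ∧ ∀ j : ℕ, j < W.length → W[j]? = some (y (q + j)) := by
    refine ⟨n + t.toNat, by omega, fun j hj => ?_⟩
    have := hyn (t.toNat + j) (by rw [abs_of_nonneg (by omega)]; push_cast; omega)
    rw [hπ, show (t.toNat : ℤ) + j + -(t.toNat : ℤ) = j by ring] at this
    rw [hz.2.2.2 j hj, ← this]
    congr 2; ring
  have hpx : PathOf X π L W (st L x q) (st L x (q + W.length)) (shiftMap q x) := by
    refine ⟨hX _ _ hx, ?_, ?_, ?_⟩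
    · apply st_congr
      intro d _ _
      simp only [shiftMap]; congr 1; ring
    · apply st_congr
      intro d _ _
      simp only [shiftMap]; congr 1; ring
    · intro j hj
      rw [hq j hj, hπ, hxy, add_comm]
  obtain ⟨u, ⟨hu, hu0, hu1, hul⟩, i, hi, hip, hui⟩ := hW _ _ _ hpx
  obtain ⟨s, hsX, s1, s2, s3, s4⟩ := hs x hx (shiftMap (-q) u) (hX _ _ hu) q (by
    intro j h1 h2
    have := st_eq hu0 (j - q) (by omega) (by omega)
    rw [show q + (j - q) = j by ring] at this
    rw [← this, shiftMap]; congr 1; ring)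
  obtain ⟨r, hrX, r1, r2, r3, r4⟩ := hs s hsX x hx (q + W.length) (by
    intro j h1 h2
    have := st_eq hu1 (j - q - W.length) (by omega) (by omega)
    rw [show q + W.length + (j - q - W.length) = j by ring] at this
    rw [← this, s2 _ (by omega), shiftMap]; congr 1; ring)
  refine ⟨r, hrX, ?_, ?_, ⟨q + W.length, by omega, fun j hj => r2 _ (by omega)⟩, q + i, by omega, ?_⟩
  · funext j
    by_cases h : j < q + W.length
    · rw [r3 _ h]
      by_cases h' : j < q
      · rw [s3 _ h', hxy]
      · rw [s4 _ (by omega), hπ]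
        have h3 := hul (j - q).toNat (by omega)
        have h4 := hq (j - q).toNat (by omega)
        rw [h3, Option.some.injEq, Int.toNat_of_nonneg (by omega)] at h4
        rw [← sub_eq_add_neg, h4]; congr 1; ring
    · rw [r4 _ (by omega), hxy]
  · intro j hj
    rw [r1 _ (by omega), s1 _ (by omega)]
  · intro j
    have := j.2
    rw [r1 _ (by omega), s2 _ (by omega), ← hui, shiftMap]
    congr 1; ring

theorem transClass_contains_rightTransitive [Fintype A] [TopologicalSpace A] [DiscreteTopology A]
    [Fintype B] [TopologicalSpace B] [DiscreteTopology B]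
    (X : Set (ℤ → A)) (Y : Set (ℤ → B)) (π : (ℤ → A) → ℤ → B)
    (hT : FactorTriple X Y π) (hXirr : IrreducibleSubshift X)
    (y : ℤ → B) (hy : RightTransitive Y y) :
    ∀ C ∈ transClassesOver X π y, ∃ x ∈ C, RightTransitive X x := by
  rintro C ⟨x, hx, hxy, rfl⟩
  obtain ⟨⟨⟨-, hX⟩, k, P, hP⟩, -, ⟨r, Φ, hΦ⟩, hXY, -⟩ := hT
  have hπ : ∀ n x j, π (shiftMap n x) j = π x (j + n) := by
    intro n x j
    rw [hΦ, hΦ]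
    congr 1
    funext i
    simp only [shiftMap]; congr 1; ring
  -- locality
  have locπ : ∀ (s z : ℤ → A) (j : ℤ), (∀ i, j - r ≤ i → i ≤ j + r → s i = z i) →
      π s j = π z j := by
    intro s z j h
    rw [hΦ, hΦ]
    congr 1
    funext i
    have := i.2
    exact h _ (by omega) (by omega)
  have locX : ∀ s : ℤ → A, (∀ j : ℤ, ∃ z ∈ X, ∀ i, j ≤ i → i < j + k → s i = z i) → s ∈ X := by
    intro s h
    rw [hP]
    intro j
    obtain ⟨z, hz, hzs⟩ := h j
    rw [hP] at hz
    have e : (fun i : Fin k => s (j + (i.1 : ℤ))) = fun i : Fin k => z (j + (i.1 : ℤ)) := by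
      funext i
      have := i.2
      exact hzs _ (by omega) (by omega)
    rw [e]
    exact hz j
  obtain ⟨L, hLk, hLr⟩ : ∃ L : ℕ, k ≤ L ∧ r + 1 ≤ L := ⟨k + r + 1, by omega, by omega⟩
  have hs : Splices X π L := by
    intro x hx z hz i h
    have a1 : ∀ j, j < i + L → (fun j => if j < i then x j else z j) j = x j := by
      intro j hj
      by_cases h' : j < i
      · simp [h']
      · simp [h', h j (by omega) hj]
    have a2 : ∀ j, i - L ≤ j → (fun j => if j < i then x j else z j) j = z j := by
      intro j hj
      by_cases h' : j < i
      · simp [h', h j hj (by omega)]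
      · simp [h']
    refine ⟨fun j => if j < i then x j else z j, ?_, a1, a2, ?_, ?_⟩
    · apply locX
      intro j
      by_cases hj : j + k ≤ i + L
      · exact ⟨x, hx, fun m _ _ => a1 m (by omega)⟩
      · exact ⟨z, hz, fun m _ _ => a2 m (by omega)⟩
    · intro j hj
      exact locπ _ _ _ fun m _ _ => a1 m (by omega)
    · intro j hj
      exact locπ _ _ _ fun m _ _ => a2 m (by omega)
  have : Nonempty (Σ p : ℕ, (Fin p → A)) := ⟨⟨0, Fin.elim0⟩⟩
  obtain ⟨f, hf⟩ := exists_surjective_nat (Σ p : ℕ, (Fin p → A))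
  -- states of the construction: points with a time after which they equal `x`
  let Q := {s : (ℤ → A) × ℤ // s.1 ∈ X ∧ π s.1 = y ∧ 0 ≤ s.2 ∧ ∀ j, s.2 ≤ j → s.1 j = x j}
  have hstep : ∀ (n : ℕ) (s : Q), ∃ s' : Q, s.1.2 + 2 * L + 1 ≤ s'.1.2 ∧
      (∀ j, j < s.1.2 + 2 * L → s'.1.1 j = s.1.1 j) ∧
      (OccursIn (f n).2 X → ∃ i : ℤ, 0 ≤ i ∧ i + (f n).1 ≤ s'.1.2 ∧
        ∀ j : Fin (f n).1, s'.1.1 (i + (j.1 : ℤ)) = (f n).2 j) := by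
    rintro n ⟨⟨s, t⟩, hsX, hsy, ht, hst⟩
    by_cases hocc : OccursIn (f n).2 X
    · obtain ⟨x', h1, h2, h3, ⟨t', ht', h4⟩, i, hi, h5⟩ :=
        step hs hX hπ hXY hXirr hy (f n).2 hocc s hsX hsy (t + 2 * L)
      dsimp only at *
      refine ⟨⟨(x', max (t' + 1) (i + (f n).1)), h1, h2, ?_, ?_⟩, ?_, h3, fun _ => ⟨i, ?_, ?_, h5⟩⟩
      · dsimp only; omega
      · intro j hj
        dsimp only at *
        rw [h4 _ (by omega), hst _ (by omega)]
      · dsimp only; omega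
      · omega
      · exact le_max_right _ _
    · refine ⟨⟨(s, t + 2 * L + 1), hsX, hsy, ?_, ?_⟩, le_rfl, fun _ _ => rfl, fun h => absurd h hocc⟩
      · dsimp only at *; omega
      · intro j hj
        dsimp only at *
        exact hst _ (by omega)
  choose g hg1 hg2 hg3 using hstep
  let F : ℕ → Q := fun n => Nat.rec ⟨(x, 0), hx, hxy, le_rfl, fun _ _ => rfl⟩ g n
  have hF : ∀ n, F (n + 1) = g n (F n) := fun n => rfl
  let T : ℕ → ℤ := fun n => (F n).1.2
  let Z : ℕ → ℤ → A := fun n => (F n).1.1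
  have hT1 : ∀ n, T n + 2 * L + 1 ≤ T (n + 1) := fun n => hg1 n (F n)
  have hZ1 : ∀ n j, j < T n + 2 * L → Z (n + 1) j = Z n j := fun n => hg2 n (F n)
  have hZocc : ∀ n, OccursIn (f n).2 X → ∃ i : ℤ, 0 ≤ i ∧ i + (f n).1 ≤ T (n + 1) ∧
        ∀ j : Fin (f n).1, Z (n + 1) (i + (j.1 : ℤ)) = (f n).2 j := fun n => hg3 n (F n)
  have hZX : ∀ n, Z n ∈ X := fun n => (F n).2.1
  have hZy : ∀ n, π (Z n) = y := fun n => (F n).2.2.1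
  have hZx : ∀ n j, T n ≤ j → Z n j = x j := fun n => (F n).2.2.2.2
  have hTge : ∀ n : ℕ, (n : ℤ) ≤ T n := by
    intro n
    induction n with
    | zero => exact (F 0).2.2.2.1
    | succ n ih => have := hT1 n; push_cast; omega
  have hTmono : ∀ n m : ℕ, T n ≤ T (n + m) := by
    intro n m
    induction m with
    | zero => simp
    | succ m ih => have := hT1 (n + m); rw [← add_assoc]; omega
  have hZ2 : ∀ n m j, j < T n + 2 * L → Z (n + m) j = Z n j := by
    intro n m j hj
    induction m with
    | zero => rfl
    | succ m ih => rw [← ih, ← add_assoc, hZ1]; have := hTmono n m; omega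
  let z : ℤ → A := fun j => Z (j.toNat + 1) j
  have hz : ∀ n j, j < T n + 2 * L → z j = Z n j := by
    intro n j hj
    have h1 : j < T (j.toNat + 1) + 2 * L := by
      have := hTge (j.toNat + 1); push_cast at this; omega
    rcases le_total n (j.toNat + 1) with h | h
    · obtain ⟨m, hm⟩ := Nat.exists_eq_add_of_le h
      show Z (j.toNat + 1) j = Z n j
      rw [hm, hZ2 n m j hj]
    · obtain ⟨m, hm⟩ := Nat.exists_eq_add_of_le h
      show Z (j.toNat + 1) j = Z n j
      rw [hm, hZ2 _ m j h1]
  have hzX : z ∈ X := by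
    apply locX
    intro j
    refine ⟨Z (j + k).toNat, hZX _, fun i _ _ => hz _ _ ?_⟩
    have := hTge (j + k).toNat
    omega
  have hzy : π z = y := by
    funext j
    rw [← hZy (j + r + 1).toNat]
    apply locπ
    intro i _ _
    apply hz
    have := hTge (j + r + 1).toNat
    omega
  refine ⟨z, ⟨hzX, by rw [hzy, hxy], ?_, ?_⟩, hzX, ?_⟩
  · -- from `x` to `z`
    intro n
    have hn := hTge n.toNat
    obtain ⟨s, hsX, s1, s2, s3, s4⟩ := hs x hx z hzX (T n.toNat + L) (by
      intro j h1 h2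
      rw [hz n.toNat j (by omega), hZx _ _ (by omega)])
    refine ⟨s, hsX, ?_, fun m hm => s1 _ (by omega), T n.toNat, by omega, fun m hm => s2 _ (by omega)⟩
    funext j
    by_cases h : j < T n.toNat + L
    · rw [s3 _ h]
    · rw [s4 _ (by omega), hzy, hxy]
  · -- from `z` to `x`
    intro n
    have hn := hTge (n + 1).toNat
    refine ⟨Z (n + 1).toNat, hZX _, by rw [hZy, hzy], fun m hm => (hz _ _ (by omega)).symm,
      T (n + 1).toNat, by omega, fun m hm => hZx _ _ hm⟩
  · intro w hw N
    obtain ⟨n, hn⟩ := hf ⟨2 * N + 1, fun j => w (-N + (j.1 : ℤ))⟩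
    have h := hZocc n
    rw [hn] at h
    obtain ⟨i, hi, hiT, hij⟩ := h ⟨w, hw, -N, fun j => rfl⟩
    dsimp only at hiT hij
    refine ⟨i + N, by omega, fun m hm => ?_⟩
    rw [abs_le] at hm
    have := hij ⟨(m + N).toNat, by omega⟩
    dsimp only at this
    rw [Int.toNat_of_nonneg (by omega)] at this
    rw [hz (n + 1) _ (by omega), show m + (i + N) = i + (m + N) by ring, this]
    congr 1; ring
end

section
/- Let (X, Y, π) be an irreducible factor triple and y ∈ Y a left transitive point. Then each transition class over y contains a left transitive point of X. -/
open Set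

universe u v uc

variable {A : Type u} {B : Type v}

/-- Boolean relations on a type, as a monoid under composition. -/
def BRel (S : Type u) : Type u := S → S → Prop

instance BRel.instMonoid (S : Type u) : Monoid (BRel S) where
  mul f g := fun a b => ∃ c, f a c ∧ g c b
  one := fun a b => a = b
  mul_assoc f g h := by
    funext a b
    apply propext
    constructor
    · rintro ⟨c, ⟨d, h1, h2⟩, h3⟩
      exact ⟨d, h1, c, h2, h3⟩
    · rintro ⟨d, h1, c, h2, h3⟩
      exact ⟨c, ⟨d, h1, h2⟩, h3⟩
  one_mul f := by
    funext a b
    apply propext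
    constructor
    · rintro ⟨c, h1, h2⟩
      have h1 : a = c := h1
      subst h1
      exact h2
    · intro h
      exact ⟨a, rfl, h⟩
  mul_one f := by
    funext a b
    apply propext
    constructor
    · rintro ⟨c, h1, h2⟩
      have h2 : c = b := h2
      subst h2
      exact h1
    · intro h
      exact ⟨b, h, rfl⟩

theorem BRel.mul_iff {S : Type u} (f g : BRel S) (a b : S) :
    (f * g) a b ↔ ∃ c, f a c ∧ g c b := Iff.rfl

instance BRel.instFinite (S : Type u) [Finite S] : Finite (BRel S) :=
  inferInstanceAs (Finite (S → S → Prop))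

theorem exists_pow_idem {M : Type u} [Monoid M] [Finite M] (f : M) :
    ∃ n : ℕ, f ^ (n + 1) * f ^ (n + 1) = f ^ (n + 1) := by
  obtain ⟨i, j, hne, hij⟩ := Finite.exists_ne_map_eq_of_infinite (fun n : ℕ => f ^ n)
  wlog hlt : i < j generalizing i j
  · exact this j i hne.symm hij.symm (by omega)
  obtain ⟨d, rfl⟩ : ∃ d, j = i + (d + 1) := ⟨j - i - 1, by omega⟩
  have hij : f ^ i = f ^ (i + (d + 1)) := hij
  have h1 : ∀ m, f ^ (i + m + (d + 1)) = f ^ (i + m) := by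
    intro m
    rw [show i + m + (d + 1) = m + (i + (d + 1)) by ring, pow_add, ← hij, ← pow_add, add_comm]
  have h2 : ∀ t m, f ^ (i + m + t * (d + 1)) = f ^ (i + m) := by
    intro t
    induction t with
    | zero => simp
    | succ t ih =>
      intro m
      rw [show i + m + (t + 1) * (d + 1) = i + (m + (d + 1)) + t * (d + 1) by ring, ih,
        ← add_assoc, h1]
  have h3 : (i + 1) * (d + 1) = i + (i * d + d) + 1 := by ring
  refine ⟨i + (i * d + d), ?_⟩
  rw [← pow_add]
  have := h2 (i + 1) (i * d + d + 1)
  rw [h3] at this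
  exact this

/-- An idempotent relation factors through recurrent states. -/
theorem BRel.exists_rec {S : Type u} [Finite S] {e : BRel S} (he : e * e = e) {a b : S}
    (hab : e a b) : ∃ c, e a c ∧ e c c ∧ e c b := by
  have htr : ∀ x y z, e x y → e y z → e x z := by
    intro x y z h1 h2
    rw [← he]
    exact ⟨y, h1, h2⟩
  have hstep : ∀ s : {s : S // e a s}, ∃ t : {s : S // e a s}, e t.1 s.1 := by
    rintro ⟨s, hs⟩
    have hs' := hs
    rw [← he] at hs'
    obtain ⟨c, h1, h2⟩ := hs'
    exact ⟨⟨c, h1⟩, h2⟩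
  choose g hg using hstep
  let f : ℕ → {s : S // e a s} := fun n => g^[n] ⟨b, hab⟩
  have hf : ∀ n, e (f (n + 1)).1 (f n).1 := by
    intro n
    have : f (n + 1) = g (f n) := Function.iterate_succ_apply' g n _
    rw [this]
    exact hg _
  have hf2 : ∀ d n, e (f (n + d + 1)).1 (f n).1 := by
    intro d
    induction d with
    | zero => exact hf
    | succ d ih =>
      intro n
      exact htr _ _ _ (hf (n + d + 1)) (ih n)
  obtain ⟨i, j, hne, hij⟩ := Finite.exists_ne_map_eq_of_infinite f
  wlog hlt : i < j generalizing i j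
  · exact this j i hne.symm hij.symm (by omega)
  obtain ⟨d, rfl⟩ : ∃ d, j = i + d + 1 := ⟨j - i - 1, by omega⟩
  have hcc := hf2 d i
  rw [← hij] at hcc
  refine ⟨(f i).1, (f i).2, hcc, ?_⟩
  rcases i with _ | i
  · exact hcc
  · have := hf2 i 0
    rw [Nat.zero_add] at this
    exact this

/-- The properties of an irreducible factor triple used in the proof. -/
structure GlueSys (X : Set (ℤ → A)) (π : (ℤ → A) → ℤ → B) (L r : ℕ) : Prop where
  sh : ∀ (n : ℤ) (x : ℤ → A), x ∈ X → shiftMap n x ∈ X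
  psh : ∀ (n : ℤ) (x : ℤ → A), π (shiftMap n x) = shiftMap n (π x)
  glue : ∀ x ∈ X, ∀ x' ∈ X, ∀ i : ℤ, (∀ m, i ≤ m → m < i + L → x m = x' m) →
    ∃ z ∈ X, (∀ m, m < i + L → z m = x m) ∧ (∀ m, i ≤ m → z m = x' m) ∧
      (∀ j, j < i + r → π z j = π x j) ∧ ∀ j, i + r ≤ j → π z j = π x' j
  loc : ∀ (y : ℤ → B) (x : ℤ → A),
    (∀ K : ℕ, ∃ x' ∈ X, π x' = y ∧ ∀ m : ℤ, -(K : ℤ) ≤ m → x m = x' m) → x ∈ X ∧ π x = y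

/-- The state (window of length `L`) of `x` at time `i`. -/
def stateAt (L : ℕ) (x : ℤ → A) (i : ℤ) : Fin L → A := fun j => x (i + (j.1 : ℤ))

theorem stateAt_eq {L : ℕ} {x x' : ℤ → A} {i i' : ℤ} (h : stateAt L x i = stateAt L x' i')
    (m : ℤ) (h0 : 0 ≤ m) (h1 : m < L) : x (i + m) = x' (i' + m) := by
  have := congrFun h ⟨m.toNat, by omega⟩
  simpa [stateAt, Int.toNat_of_nonneg h0] using this

/-- `x` starts in state `a`, ends in state `b` and lies over the word `w`. -/
def IsPathOver (X : Set (ℤ → A)) (π : (ℤ → A) → ℤ → B) (L r : ℕ) (w : List B)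
    (a b : Fin L → A) (x : ℤ → A) : Prop :=
  x ∈ X ∧ stateAt L x 0 = a ∧ stateAt L x w.length = b ∧
    ∀ (j : ℕ) (h : j < w.length), π x ((r : ℤ) + j) = w[j]

/-- Relation induced by the word `w`. -/
def wordRel (X : Set (ℤ → A)) (π : (ℤ → A) → ℤ → B) (L r : ℕ) (w : List B) :
    BRel (Fin L → A) :=
  fun a b => ∃ x, IsPathOver X π L r w a b x

/-- Relation induced by the word `w` using only paths that see the block `v`. -/
def markRel (X : Set (ℤ → A)) (π : (ℤ → A) → ℤ → B) (L r : ℕ) {q : ℕ} (v : Fin q → A)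
    (w : List B) : BRel (Fin L → A) :=
  fun a b => ∃ x, IsPathOver X π L r w a b x ∧
    ∃ p : ℤ, 0 ≤ p ∧ p + q ≤ w.length ∧ ∀ j : Fin q, x (p + (j.1 : ℤ)) = v j

section
variable {X : Set (ℤ → A)} {π : (ℤ → A) → ℤ → B} {L r : ℕ}

theorem GlueSys.comp (G : GlueSys X π L r) {w w' : List B} {a b c : Fin L → A} {x x' : ℤ → A}
    (h : IsPathOver X π L r w a c x) (h' : IsPathOver X π L r w' c b x') :
    ∃ z, IsPathOver X π L r (w ++ w') a b z ∧ (∀ m : ℤ, m < w.length + L → z m = x m) ∧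
      ∀ m : ℤ, 0 ≤ m → z (w.length + m) = x' m := by
  obtain ⟨hx, ha, hc, hw⟩ := h
  obtain ⟨hx', hc', hb, hw'⟩ := h'
  obtain ⟨z, hz, z1, z2, z3, z4⟩ := G.glue x hx (shiftMap (-(w.length : ℤ)) x')
    (G.sh _ _ hx') w.length (by
      intro m h1 h2
      have := stateAt_eq (hc.trans hc'.symm) (m - w.length) (by omega) (by omega)
      simp only [shiftMap]
      convert this using 2 <;> ring)
  have z5 : ∀ m : ℤ, 0 ≤ m → z (w.length + m) = x' m := by
    intro m hm
    rw [z2 _ (by omega)]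
    simp only [shiftMap]
    congr 1
    ring
  refine ⟨z, ⟨hz, ?_, ?_, ?_⟩, z1, z5⟩
  · rw [← ha]
    funext j
    have := j.2
    exact z1 _ (by omega)
  · rw [← hb]
    funext j
    simp only [stateAt, List.length_append]
    rw [← z5 _ (by omega)]
    congr 1
    push_cast
    ring
  · intro j hj
    rw [List.getElem_append]
    split_ifs with hlt
    · rw [z3 _ (by omega)]
      exact hw j hlt
    · rw [z4 _ (by omega), G.psh]
      rw [List.length_append] at hj
      rw [← hw' (j - w.length) (by omega)]
      simp only [shiftMap]
      congr 1
      omega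

theorem GlueSys.rel_append (G : GlueSys X π L r) (w w' : List B) :
    wordRel X π L r (w ++ w') = wordRel X π L r w * wordRel X π L r w' := by
  funext a b
  apply propext
  rw [BRel.mul_iff]
  constructor
  · rintro ⟨x, hx, ha, hb, hw⟩
    refine ⟨stateAt L x w.length, ⟨x, hx, ha, rfl, ?_⟩, shiftMap w.length x, G.sh _ _ hx, ?_, ?_, ?_⟩
    · intro j hj
      rw [hw j (by rw [List.length_append]; omega), List.getElem_append_left hj]
    · funext j
      simp only [stateAt, shiftMap]
      congr 1
      ring
    · rw [← hb]
      funext j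
      simp only [stateAt, shiftMap, List.length_append]
      congr 1
      push_cast
      ring
    · intro j hj
      rw [G.psh]
      have := hw (w.length + j) (by rw [List.length_append]; omega)
      rw [List.getElem_append_right (by omega)] at this
      simp only [Nat.add_sub_cancel_left] at this
      rw [← this]
      simp only [shiftMap]
      congr 1
      push_cast
      ring
  · rintro ⟨c, ⟨x, hx⟩, x', hx'⟩
    obtain ⟨z, hz, -⟩ := G.comp hx hx'
    exact ⟨z, hz⟩

theorem GlueSys.mark_left (G : GlueSys X π L r) {q : ℕ} {v : Fin q → A} {w w' : List B}
    {a b c : Fin L → A} (h : markRel X π L r v w a c) (h' : wordRel X π L r w' c b) :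
    markRel X π L r v (w ++ w') a b := by
  obtain ⟨x, hx, p, p0, p1, hp⟩ := h
  obtain ⟨x', hx'⟩ := h'
  obtain ⟨z, hz, z1, z2⟩ := G.comp hx hx'
  refine ⟨z, hz, p, p0, ?_, ?_⟩
  · rw [List.length_append]
    push_cast
    omega
  · intro j
    have := j.2
    rw [z1 _ (by omega)]
    exact hp j

theorem GlueSys.mark_right (G : GlueSys X π L r) {q : ℕ} {v : Fin q → A} {w w' : List B}
    {a b c : Fin L → A} (h : wordRel X π L r w a c) (h' : markRel X π L r v w' c b) :
    markRel X π L r v (w ++ w') a b := by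
  obtain ⟨x, hx⟩ := h
  obtain ⟨x', hx', p, p0, p1, hp⟩ := h'
  obtain ⟨z, hz, z1, z2⟩ := G.comp hx hx'
  refine ⟨z, hz, w.length + p, by omega, ?_, ?_⟩
  · rw [List.length_append]
    push_cast
    omega
  · intro j
    rw [add_assoc, z2 _ (by omega)]
    exact hp j

theorem markRel_le {q : ℕ} {v : Fin q → A} {w : List B} {a b : Fin L → A}
    (h : markRel X π L r v w a b) : wordRel X π L r w a b := by
  obtain ⟨x, hx, -⟩ := h
  exact ⟨x, hx⟩

theorem GlueSys.pow_word (G : GlueSys X π L r) {q : ℕ} {v : Fin q → A} {u : List B}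
    {c : Fin L → A} (h : markRel X π L r v u c c) (n : ℕ) :
    ∃ W, wordRel X π L r W = wordRel X π L r u ^ (n + 1) ∧ markRel X π L r v W c c := by
  induction n with
  | zero => exact ⟨u, by simp, h⟩
  | succ n ih =>
    obtain ⟨W, h1, h2⟩ := ih
    exact ⟨W ++ u, by rw [G.rel_append, h1, ← pow_succ], G.mark_left h2 (markRel_le h)⟩

/-- By irreducibility every occurring state returns to itself seeing `v`. -/
theorem GlueSys.exists_return (G : GlueSys X π L r) [TopologicalSpace A]
    (hirr : IrreducibleSubshift X) {q : ℕ} {v : Fin q → A} (hv : OccursIn v X)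
    {c : Fin L → A} (hc : OccursIn c X) : ∃ p, markRel X π L r v p c c := by
  obtain ⟨x, hx, i, k, hik, hxc, hxv⟩ := hirr L q c v hc hv
  obtain ⟨n, hn⟩ : ∃ n : ℕ, (n : ℤ) = k + q - i := ⟨(k + q - i).toNat, by omega⟩
  obtain ⟨z, hz, i', k', hik', hzu, hzc⟩ := hirr n L (fun j => x (i + (j.1 : ℤ))) c
    ⟨x, hx, i, fun _ => rfl⟩ hc
  obtain ⟨N, hN⟩ : ∃ N : ℕ, (N : ℤ) = k' - i' := ⟨(k' - i').toNat, by omega⟩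
  have hzu' : ∀ m : ℤ, 0 ≤ m → m < n → z (i' + m) = x (i + m) := by
    intro m h0 h1
    have := hzu ⟨m.toNat, by omega⟩
    simpa [Int.toNat_of_nonneg h0] using this
  refine ⟨List.ofFn (fun j : Fin N => π (shiftMap i' z) ((r : ℤ) + (j.1 : ℤ))),
    shiftMap i' z, ⟨G.sh _ _ hz, ?_, ?_, ?_⟩, k - i, by omega, ?_, ?_⟩
  · funext j
    have := j.2
    rw [← hxc j]
    simp only [stateAt, shiftMap]
    rw [← hzu' _ (by omega) (by omega)]
    congr 1
    ring
  · funext j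
    rw [← hzc j]
    simp only [stateAt, shiftMap, List.length_ofFn]
    congr 1
    omega
  · intro j hj
    simp
  · simp only [List.length_ofFn]
    omega
  · intro j
    have := j.2
    rw [← hxv j]
    simp only [shiftMap]
    rw [show k - i + (j.1 : ℤ) + i' = i' + (k - i + j.1) by ring, hzu' _ (by omega) (by omega)]
    congr 1
    ring

theorem wordRel_occurs {w : List B} {a b : Fin L → A} (h : wordRel X π L r w a b) :
    OccursIn a X := by
  obtain ⟨x, hx, ha, -⟩ := h
  exact ⟨x, hx, 0, fun j => congrFun ha j⟩

/-- There is a word all of whose preimages can be rerouted through `v`. -/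
theorem GlueSys.exists_word (G : GlueSys X π L r) [TopologicalSpace A] [Finite A]
    (hirr : IrreducibleSubshift X) {q : ℕ} {v : Fin q → A} (hv : OccursIn v X) :
    ∃ W : List B, (∃ a b, wordRel X π L r W a b) ∧
      ∀ a b, wordRel X π L r W a b → markRel X π L r v W a b := by
  -- the predicate: nonzero idempotent word
  let Q : List B → Prop := fun w => wordRel X π L r w * wordRel X π L r w = wordRel X π L r w ∧
    ∃ a b, wordRel X π L r w a b
  have hQ : ∃ w, Q w := by
    have hv' := hv
    obtain ⟨x, hx, -⟩ := hv'
    obtain ⟨p, hp⟩ := G.exists_return hirr hv (c := stateAt L x 0) ⟨x, hx, 0, fun _ => rfl⟩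
    obtain ⟨n, hn⟩ := exists_pow_idem (wordRel X π L r p)
    obtain ⟨W, h1, h2⟩ := G.pow_word hp n
    exact ⟨W, by rw [h1, hn], _, _, markRel_le h2⟩
  obtain ⟨w, ⟨hwi, hwn⟩, hmin⟩ := exists_minimalFor_of_wellFoundedLT Q
    (fun w => Nat.card {s : BRel (Fin L → A) | wordRel X π L r w * s = s}) hQ
  have hprim : ∀ w', Q w' → wordRel X π L r w * wordRel X π L r w' = wordRel X π L r w' →
      wordRel X π L r w' * wordRel X π L r w = wordRel X π L r w' →
      wordRel X π L r w' = wordRel X π L r w := by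
    intro w' hw' h1 h2
    have hsub : {s : BRel (Fin L → A) | wordRel X π L r w' * s = s} ⊆
        {s : BRel (Fin L → A) | wordRel X π L r w * s = s} := by
      intro s hs
      have hs : wordRel X π L r w' * s = s := hs
      show wordRel X π L r w * s = s
      rw [← hs, ← mul_assoc, h1]
    have hle : Nat.card {s : BRel (Fin L → A) | wordRel X π L r w' * s = s} ≤
        Nat.card {s : BRel (Fin L → A) | wordRel X π L r w * s = s} :=
      Nat.card_mono (Set.toFinite _) hsub
    have hge := hmin hw' hle
    have heq := Set.eq_of_subset_of_ncard_le hsub hge (Set.toFinite _)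
    have hmem : wordRel X π L r w ∈ {s : BRel (Fin L → A) | wordRel X π L r w * s = s} := hwi
    rw [← heq] at hmem
    have hmem : wordRel X π L r w' * wordRel X π L r w = wordRel X π L r w := hmem
    rw [← h2, hmem]
  have hrec : ∀ c, wordRel X π L r w c c →
      ∃ W, wordRel X π L r W = wordRel X π L r w ∧ markRel X π L r v W c c := by
    intro c hc
    obtain ⟨p, hp⟩ := G.exists_return hirr hv (wordRel_occurs hc)
    have hu : markRel X π L r v (w ++ p ++ w) c c := G.mark_left (G.mark_right hc hp) hc
    obtain ⟨n, hn⟩ := exists_pow_idem (wordRel X π L r (w ++ p ++ w))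
    obtain ⟨W, h1, h2⟩ := G.pow_word hu n
    refine ⟨W, hprim W ⟨by rw [h1, hn], _, _, markRel_le h2⟩ ?_ ?_, h2⟩
    · rw [h1, pow_succ', G.rel_append, G.rel_append]
      simp only [← mul_assoc]
      rw [hwi]
    · rw [h1, pow_succ, G.rel_append, G.rel_append]
      simp only [mul_assoc]
      rw [hwi]
  have hall : ∀ T : Set (Fin L → A), T.Finite →
      ∃ W, wordRel X π L r W = wordRel X π L r w ∧
        ∀ c ∈ T, wordRel X π L r w c c → markRel X π L r v W c c := by
    intro T hT
    induction T, hT using Set.Finite.induction_on with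
    | empty => exact ⟨w, rfl, by simp⟩
    | @insert d T _ _ ih =>
      obtain ⟨W, h1, h2⟩ := ih
      by_cases hd : wordRel X π L r w d d
      · obtain ⟨W', h3, h4⟩ := hrec d hd
        refine ⟨W ++ W', by rw [G.rel_append, h1, h3, hwi], ?_⟩
        rintro c (rfl | hc) hcc
        · exact G.mark_right (by rw [h1]; exact hcc) h4
        · exact G.mark_left (h2 c hc hcc) (by rw [h3]; exact hcc)
      · refine ⟨W, h1, ?_⟩
        rintro c (rfl | hc) hcc
        · exact absurd hcc hd
        · exact h2 c hc hcc
  obtain ⟨W, h1, h2⟩ := hall Set.univ (Set.toFinite _)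
  have hE : wordRel X π L r (w ++ W ++ w) = wordRel X π L r w := by
    rw [G.rel_append, G.rel_append, h1, hwi, hwi]
  refine ⟨w ++ W ++ w, by rw [hE]; exact hwn, ?_⟩
  intro a b hab
  rw [hE] at hab
  obtain ⟨c, hac, hcc, hcb⟩ := BRel.exists_rec hwi hab
  exact G.mark_left (G.mark_right hac (h2 c trivial hcc)) hcb

/-- Rerouting once, far to the left, so as to see the block `v`. -/
theorem GlueSys.reroute (G : GlueSys X π L r) [TopologicalSpace A] [Finite A]
    (hirr : IrreducibleSubshift X) {q : ℕ} {v : Fin q → A} (hv : OccursIn v X)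
    {Y : Set (ℤ → B)} (hXY : ∀ x ∈ X, π x ∈ Y) (hYsh : ∀ (n : ℤ), ∀ y ∈ Y, shiftMap n y ∈ Y)
    {y : ℤ → B} (hy : LeftTransitive Y y) {x : ℤ → A} (hx : x ∈ X) (hxy : π x = y) (K : ℕ) :
    ∃ x' ∈ X, π x' = y ∧ (∀ m : ℤ, -(K : ℤ) ≤ m → x' m = x m) ∧
      ∃ p : ℤ, p + q ≤ -(K : ℤ) ∧ ∀ j : Fin q, x' (p + (j.1 : ℤ)) = v j := by
  obtain ⟨W, ⟨a, b, z0, hz0, -, -, hz0W⟩, hW⟩ := G.exists_word hirr hv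
  obtain ⟨n, hn0, hn⟩ := hy.2 (shiftMap ((r : ℤ) + (K + W.length + L : ℕ)) (π z0))
    (hYsh _ _ (hXY _ hz0)) (K + W.length + L)
  obtain ⟨s, hs⟩ : ∃ s : ℤ, s = -((K + W.length + L : ℕ) : ℤ) + n - r := ⟨_, rfl⟩
  have hyW : ∀ (j : ℕ) (h : j < W.length), y (s + (r + j)) = W[j] := by
    intro j hj
    rw [← hz0W j hj]
    have := hn (-((K + W.length + L : ℕ) : ℤ) + j) (by rw [abs_le]; constructor <;> omega)
    simp only [shiftMap] at this
    rw [show s + (r + (j : ℤ)) = -((K + W.length + L : ℕ) : ℤ) + j + n by omega, this]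
    congr 1
    ring
  have hpath : wordRel X π L r W (stateAt L x s) (stateAt L x (s + W.length)) := by
    refine ⟨shiftMap s x, G.sh _ _ hx, ?_, ?_, ?_⟩
    · funext j
      simp only [stateAt, shiftMap]
      congr 1
      ring
    · funext j
      simp only [stateAt, shiftMap]
      congr 1
      ring
    · intro j hj
      rw [G.psh, ← hyW j hj, hxy]
      simp only [shiftMap]
      congr 1
      ring
  obtain ⟨x1, ⟨hx1, hx1a, hx1b, hx1W⟩, p, hp0, hp1, hp⟩ := hW _ _ hpath
  -- glue `x1` and `x` at time `s + W.length`
  obtain ⟨z, hz, z1, z2, z3, z4⟩ := G.glue (shiftMap (-s) x1) (G.sh _ _ hx1) x hx (s + W.length) (by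
    intro m h1 h2
    have := stateAt_eq hx1b (m - s - W.length) (by omega) (by omega)
    simp only [shiftMap]
    rw [show m + -s = W.length + (m - s - W.length) by ring, this]
    congr 1
    ring)
  obtain ⟨t, ht, t1, t2, t3, t4⟩ := G.glue x hx z hz s (by
    intro m h1 h2
    have := stateAt_eq hx1a (m - s) (by omega) (by omega)
    rw [z1 _ (by omega)]
    simp only [shiftMap]
    rw [show m + -s = 0 + (m - s) by ring, this]
    congr 1
    ring)
  refine ⟨t, ht, ?_, ?_, s + p, by omega, ?_⟩
  · funext j
    rcases lt_or_ge j (s + r) with h | h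
    · rw [t3 _ h, hxy]
    · rw [t4 _ h]
      rcases lt_or_ge j (s + W.length + r) with h' | h'
      · rw [z3 _ h', G.psh]
        obtain ⟨i, hi⟩ : ∃ i : ℕ, (i : ℤ) = j - s - r := ⟨(j - s - r).toNat, by omega⟩
        have e1 := hx1W i (by omega)
        have e2 := hyW i (by omega)
        simp only [shiftMap]
        rw [show j + -s = r + i by omega, e1, ← e2]
        congr 1
        omega
      · rw [z4 _ h', hxy]
  · intro m hm
    rw [t2 _ (by omega), z2 _ (by omega)]
  · intro j
    have := j.2
    rw [t2 _ (by omega), z1 _ (by omega), ← hp j]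
    simp only [shiftMap]
    congr 1
    ring

/-- Infinitely many reroutings produce a left transitive point. -/
theorem GlueSys.exists_leftTransitive (G : GlueSys X π L r) [TopologicalSpace A] [Finite A]
    (hirr : IrreducibleSubshift X)
    {Y : Set (ℤ → B)} (hXY : ∀ x ∈ X, π x ∈ Y) (hYsh : ∀ (n : ℤ), ∀ y ∈ Y, shiftMap n y ∈ Y)
    {y : ℤ → B} (hy : LeftTransitive Y y) {x : ℤ → A} (hx : x ∈ X) (hxy : π x = y) :
    ∃ x', LeftTransitive X x' ∧ π x' = y ∧ ∀ m : ℤ, 0 ≤ m → x' m = x m := by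
  have : Nonempty (Σ q : ℕ, (Fin q → A)) := ⟨⟨0, Fin.elim0⟩⟩
  obtain ⟨f, hf⟩ := exists_surjective_nat (Σ q : ℕ, (Fin q → A))
  let St := {s : (ℤ → A) × ℕ // s.1 ∈ X ∧ π s.1 = y}
  have hstep : ∀ (n : ℕ) (s : St), ∃ t : St, s.1.2 < t.1.2 ∧
      (∀ m : ℤ, -(s.1.2 : ℤ) ≤ m → t.1.1 m = s.1.1 m) ∧
      (OccursIn (f n).2 X → ∃ p : ℤ, -(t.1.2 : ℤ) ≤ p ∧ p + (f n).1 ≤ -(s.1.2 : ℤ) ∧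
        ∀ j : Fin (f n).1, t.1.1 (p + (j.1 : ℤ)) = (f n).2 j) := by
    rintro n ⟨⟨s, K⟩, hsX, hsy⟩
    by_cases ho : OccursIn (f n).2 X
    · obtain ⟨x', h1, h2, h3, p, h4, h5⟩ := G.reroute hirr ho hXY hYsh hy hsX hsy K
      refine ⟨⟨⟨x', K + 1 + p.natAbs⟩, h1, h2⟩, ?_, h3, fun _ => ⟨p, ?_, h4, h5⟩⟩
      · show K < K + 1 + p.natAbs
        omega
      · show -((K + 1 + p.natAbs : ℕ) : ℤ) ≤ p
        omega
    · exact ⟨⟨⟨s, K + 1⟩, hsX, hsy⟩, Nat.lt_succ_self K, fun _ _ => rfl, fun h => absurd h ho⟩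
  choose g hg1 hg2 hg3 using hstep
  let S : ℕ → St := fun n => Nat.rec ⟨⟨x, 0⟩, hx, hxy⟩ (fun n s => g n s) n
  have hS0 : S 0 = ⟨⟨x, 0⟩, hx, hxy⟩ := rfl
  have hS : ∀ n, S (n + 1) = g n (S n) := fun n => rfl
  have hK : ∀ n, n ≤ (S n).1.2 := by
    intro n
    induction n with
    | zero => exact Nat.zero_le _
    | succ n ih =>
      have := hg1 n (S n)
      rw [← hS] at this
      omega
  have hKm : ∀ d n, (S n).1.2 ≤ (S (n + d)).1.2 := by
    intro d
    induction d with
    | zero => intro n; exact le_rfl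
    | succ d ih =>
      intro n
      have := hg1 (n + d) (S (n + d))
      rw [← hS] at this
      have := ih n
      rw [← add_assoc]
      omega
  have hag : ∀ d n, ∀ m : ℤ, -((S n).1.2 : ℤ) ≤ m → (S (n + d)).1.1 m = (S n).1.1 m := by
    intro d
    induction d with
    | zero => intro n m _; rfl
    | succ d ih =>
      intro n m hm
      have h1 := hKm d n
      rw [← ih n m hm, ← add_assoc, hS, hg2 _ _ m (by omega)]
  let x' : ℤ → A := fun m => (S m.natAbs).1.1 m
  have hx' : ∀ n, ∀ m : ℤ, -((S n).1.2 : ℤ) ≤ m → x' m = (S n).1.1 m := by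
    intro n m hm
    show (S m.natAbs).1.1 m = _
    have h1 := hag n m.natAbs m (by have := hK m.natAbs; omega)
    have h2 := hag m.natAbs n m hm
    rw [← h1, ← h2, add_comm]
  obtain ⟨hX', hy'⟩ := G.loc y x' (by
    intro K
    refine ⟨(S K).1.1, (S K).2.1, (S K).2.2, fun m hm => hx' K m ?_⟩
    have := hK K
    omega)
  refine ⟨x', ⟨hX', ?_⟩, hy', ?_⟩
  · intro z hz N
    obtain ⟨n, hn⟩ := hf ⟨2 * N + 1, fun j => z (-(N : ℤ) + (j.1 : ℤ))⟩
    have h3 := hg3 n (S n)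
    rw [← hS, hn] at h3
    obtain ⟨p, hp1, hp2, hp3⟩ := h3 ⟨z, hz, -(N : ℤ), fun _ => rfl⟩
    simp only at hp2 hp3
    push_cast at hp2
    refine ⟨p + N, by omega, ?_⟩
    intro m hm
    rw [abs_le] at hm
    have := hp3 ⟨(m + N).toNat, by omega⟩
    simp only at this
    rw [Int.toNat_of_nonneg (by omega)] at this
    rw [hx' (n + 1) _ (by omega), show m + (p + N) = p + (m + N) by ring, this]
    congr 1
    ring
  · intro m hm
    rw [hx' 0 m (by rw [hS0]; simpa using hm), hS0]

end

theorem GlueSys.of_sft {X : Set (ℤ → A)} {π : (ℤ → A) → ℤ → B}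
    (hsh : ∀ n : ℤ, ∀ x ∈ X, shiftMap n x ∈ X) {k : ℕ} {P : (Fin k → A) → Prop}
    (hX : X = {x | ∀ i : ℤ, P fun j => x (i + (j.1 : ℤ))}) {r : ℕ}
    {Φ : (Fin (2 * r + 1) → A) → B} (hπ : ∀ x i, π x i = Φ fun j => x (i - (r : ℤ) + (j.1 : ℤ))) :
    GlueSys X π (k + 2 * r + 1) r where
  sh := hsh
  psh n x := by
    funext i
    simp only [shiftMap]
    rw [hπ, hπ]
    congr 1
    funext j
    simp only [shiftMap]
    congr 1
    ring
  glue x hx x' hx' i h := by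
    classical
    let z : ℤ → A := fun m => if m < i then x m else x' m
    have z1 : ∀ m, m < i + ((k + 2 * r + 1 : ℕ) : ℤ) → z m = x m := by
      intro m hm
      simp only [z]
      split_ifs with h1
      · rfl
      · exact (h m (by omega) hm).symm
    have z2 : ∀ m, i ≤ m → z m = x' m := by
      intro m hm
      simp only [z]
      rw [if_neg (by omega)]
    refine ⟨z, ?_, z1, z2, ?_, ?_⟩
    · rw [hX] at hx hx' ⊢
      intro l
      rcases lt_or_ge l i with hl | hl
      · have := hx l
        convert this using 2 with j
        have := j.2
        exact z1 _ (by omega)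
      · have := hx' l
        convert this using 2 with j
        exact z2 _ (by omega)
    · intro j hj
      rw [hπ, hπ]
      congr 1
      funext l
      have := l.2
      exact z1 _ (by omega)
    · intro j hj
      rw [hπ, hπ]
      congr 1
      funext l
      exact z2 _ (by omega)
  loc y x h := by
    constructor
    · rw [hX]
      intro i
      obtain ⟨x', hx', -, hm⟩ := h i.natAbs
      rw [hX] at hx'
      have := hx' i
      convert this using 2 with j
      exact hm _ (by omega)
    · funext i
      obtain ⟨x', hx', hy, hm⟩ := h (i.natAbs + r)
      rw [← hy, hπ, hπ]
      congr 1
      funext j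
      exact hm _ (by omega)

theorem transClass_contains_leftTransitive [Fintype A] [TopologicalSpace A] [DiscreteTopology A]
    [Fintype B] [TopologicalSpace B] [DiscreteTopology B]
    (X : Set (ℤ → A)) (Y : Set (ℤ → B)) (π : (ℤ → A) → ℤ → B)
    (hT : FactorTriple X Y π) (hXirr : IrreducibleSubshift X)
    (y : ℤ → B) (hy : LeftTransitive Y y) :
    ∀ C ∈ transClassesOver X π y, ∃ x ∈ C, LeftTransitive X x := by
  rintro C ⟨x, hx, hxy, rfl⟩
  obtain ⟨⟨⟨-, hsh⟩, k, P, hX⟩, ⟨-, hYsh⟩, ⟨r, Φ, hπ⟩, hXY, -⟩ := hT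
  have G := GlueSys.of_sft hsh hX hπ
  obtain ⟨x', hlt, hy', hag⟩ := G.exists_leftTransitive hXirr hXY hYsh hy hx hxy
  refine ⟨x', ⟨hlt.1, hy'.trans hxy.symm, ?_, ?_⟩, hlt⟩
  · intro n
    refine ⟨x, hx, rfl, fun _ _ => rfl, max n 0, le_max_left _ _, fun m hm => ?_⟩
    exact (hag m ((le_max_right _ _).trans hm)).symm
  · intro n
    refine ⟨x', hlt.1, rfl, fun _ _ => rfl, max n 0, le_max_left _ _, fun m hm => ?_⟩
    exact hag m ((le_max_right _ _).trans hm)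
end

section
/- Let (X, Y, π) be an irreducible factor triple and y ∈ Y a doubly transitive point. Then each transition class over y contains a doubly transitive point of X. -/
open Set

universe u v uc

variable {A : Type u} {B : Type v}

namespace TC

/-- `RPath E lab w a b`: a path from `a` to `b` whose successive vertex labels read `w`. -/
def RPath {S : Type*} {L : Type*} (E : S → S → Prop) (lab : S → L) : List L → S → S → Prop
  | [], a, b => a = b
  | c :: w, a, b => ∃ a', E a a' ∧ lab a' = c ∧ RPath E lab w a' b

/-- A path passing through `t`. -/
def GPath {S : Type*} {L : Type*} (E : S → S → Prop) (lab : S → L) (t : S)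
    (w : List L) (a b : S) : Prop :=
  ∃ w1 w2, w = w1 ++ w2 ∧ RPath E lab w1 a t ∧ RPath E lab w2 t b

section rel
variable {S : Type*} {L : Type*} {E : S → S → Prop} {lab : S → L} {t : S}

theorem rpath_append {w1 w2 : List L} {a b : S} :
    RPath E lab (w1 ++ w2) a b ↔ ∃ c, RPath E lab w1 a c ∧ RPath E lab w2 c b := by
  induction w1 generalizing a with
  | nil => simp [RPath]
  | cons c w ih =>
    simp only [List.cons_append, RPath, ih]
    constructor
    · rintro ⟨a', h1, h2, c', h3, h4⟩
      exact ⟨c', ⟨a', h1, h2, h3⟩, h4⟩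
    · rintro ⟨c', ⟨a', h1, h2, h3⟩, h4⟩
      exact ⟨a', h1, h2, c', h3, h4⟩

theorem rpath_trans {w1 w2 : List L} {a b c : S} (h1 : RPath E lab w1 a b)
    (h2 : RPath E lab w2 b c) : RPath E lab (w1 ++ w2) a c :=
  rpath_append.2 ⟨b, h1, h2⟩

theorem gpath_left {w1 w2 : List L} {a b c : S} (h1 : RPath E lab w1 a b)
    (h2 : GPath E lab t w2 b c) : GPath E lab t (w1 ++ w2) a c := by
  obtain ⟨u1, u2, rfl, h3, h4⟩ := h2
  exact ⟨w1 ++ u1, u2, by simp, rpath_trans h1 h3, h4⟩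

theorem gpath_right {w1 w2 : List L} {a b c : S} (h1 : GPath E lab t w1 a b)
    (h2 : RPath E lab w2 b c) : GPath E lab t (w1 ++ w2) a c := by
  obtain ⟨u1, u2, rfl, h3, h4⟩ := h1
  exact ⟨u1, u2 ++ w2, by simp, h3, rpath_trans h4 h2⟩

/-- `k`-th power of a word. -/
def wpow (q : List L) : ℕ → List L
  | 0 => []
  | k + 1 => wpow q k ++ q

theorem wpow_add (q : List L) (j k : ℕ) : wpow q (j + k) = wpow q j ++ wpow q k := by
  induction k with
  | zero => simp [wpow]
  | succ k ih => rw [← add_assoc]; simp [wpow, ih]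

theorem rpath_wpow {q : List L} {f : ℕ → S} (j n : ℕ)
    (h : ∀ l, j ≤ l → l < j + n → RPath E lab q (f l) (f (l + 1))) :
    RPath E lab (wpow q n) (f j) (f (j + n)) := by
  induction n with
  | zero => simp [wpow, RPath]
  | succ n ih =>
    exact rpath_trans (ih fun l h1 h2 => h l h1 (by omega)) (h (j + n) (by omega) (by omega))

theorem rpath_loop {q : List L} {a : S} (n : ℕ) (h : RPath E lab q a a) :
    RPath E lab (wpow q n) a a :=
  rpath_wpow (f := fun _ => a) 0 n fun _ _ _ => h

theorem gpath_loop {q : List L} {a : S} (n : ℕ) (hn : 0 < n) (h : RPath E lab q a a)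
    (hg : GPath E lab t q a a) : GPath E lab t (wpow q n) a a := by
  obtain ⟨k, rfl⟩ : ∃ k, n = k + 1 := ⟨n - 1, by omega⟩
  exact gpath_left (rpath_loop k h) hg

/-- Bad paths over `w1 q^k w2` go through a sequence of vertices of `M`. -/
theorem bad_seq {M : Finset S} {w1 w2 g : List L}
    (hM : ∀ a b, RPath E lab (w1 ++ w2) a b → ¬ GPath E lab t (w1 ++ w2) a b →
      ∃ m ∈ M, RPath E lab w1 a m ∧ RPath E lab w2 m b) (k : ℕ) :
    ∀ a b, RPath E lab (w1 ++ wpow (w2 ++ g ++ w1) k ++ w2) a b →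
      ¬ GPath E lab t (w1 ++ wpow (w2 ++ g ++ w1) k ++ w2) a b →
      ∃ f : ℕ → S, (∀ l ≤ k, f l ∈ M) ∧ RPath E lab w1 a (f 0) ∧
        (∀ l < k, RPath E lab (w2 ++ g ++ w1) (f l) (f (l + 1))) ∧ RPath E lab w2 (f k) b := by
  induction k with
  | zero =>
    intro a b h1 h2
    obtain ⟨m, hm, h3, h4⟩ := hM a b (by simpa [wpow] using h1) (by simpa [wpow] using h2)
    exact ⟨fun _ => m, by simp [hm], h3, by simp, h4⟩
  | succ k ih =>
    intro a b h1 h2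
    have e : w1 ++ wpow (w2 ++ g ++ w1) (k + 1) ++ w2 =
      (w1 ++ wpow (w2 ++ g ++ w1) k ++ w2) ++ (g ++ (w1 ++ w2)) := by simp [wpow]
    rw [e] at h1 h2
    obtain ⟨c, h3, h4⟩ := rpath_append.1 h1
    obtain ⟨d, h5, h6⟩ := rpath_append.1 h4
    obtain ⟨f, hf1, hf2, hf3, hf4⟩ := ih a c h3 fun hg => h2 (gpath_right hg h4)
    obtain ⟨m, hm, h7, h8⟩ := hM d b h6 fun hg => h2 (gpath_left h3 (gpath_left h5 hg))
    refine ⟨fun l => if l ≤ k then f l else m, ?_, by simpa using hf2, ?_, by simpa using h8⟩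
    · intro l _
      dsimp only
      split_ifs with h
      · exact hf1 l h
      · exact hm
    · intro l hl
      rcases Nat.lt_or_ge l k with h | h
      · simpa [h.le, Nat.succ_le_of_lt h] using hf3 l h
      · obtain rfl : l = k := by omega
        simpa using rpath_trans hf4 (rpath_trans h5 h7)

theorem exists_good_word [Finite S] (conn : ∀ a b : S, ∃ w, RPath E lab w a b) (t : S) :
    ∃ w : List L, (∃ a b, RPath E lab w a b) ∧
      ∀ a b, RPath E lab w a b → GPath E lab t w a b := by
  classical
  have := Fintype.ofFinite S
  suffices H : ∀ (M : Finset S) (w1 w2 : List L), (∃ a b, RPath E lab (w1 ++ w2) a b) →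
      (∀ a b, RPath E lab (w1 ++ w2) a b → ¬ GPath E lab t (w1 ++ w2) a b →
      ∃ m ∈ M, RPath E lab w1 a m ∧ RPath E lab w2 m b) → ∃ w : List L,
      (∃ a b, RPath E lab w a b) ∧ ∀ a b, RPath E lab w a b → GPath E lab t w a b by
    refine H Finset.univ [] [] ⟨t, t, by simp [RPath]⟩ ?_
    intro a b h _
    exact ⟨a, by simp, by simp [RPath], by simpa using h⟩
  intro M
  induction M using Finset.strongInduction with
  | H M ih =>
  intro w1 w2 hre hM
  rcases M.eq_empty_or_nonempty with rfl | ⟨a, ha⟩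
  · refine ⟨w1 ++ w2, hre, fun a b h => ?_⟩
    by_contra hg
    obtain ⟨m, hm, _⟩ := hM a b h hg
    simp at hm
  have hss : M.erase a ⊂ M := Finset.erase_ssubset ha
  by_cases hr : ∃ e f, RPath E lab w1 e a ∧ RPath E lab w2 a f
  swap
  · refine ih _ hss w1 w2 hre ?_
    intro e f h hg
    obtain ⟨m, hm, h1, h2⟩ := hM e f h hg
    refine ⟨m, Finset.mem_erase.2 ⟨?_, hm⟩, h1, h2⟩
    rintro rfl
    exact hr ⟨e, f, h1, h2⟩
  obtain ⟨e, f, he, hf⟩ := hr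
  obtain ⟨g1, hg1⟩ := conn f t
  obtain ⟨g2, hg2⟩ := conn t e
  have hq : RPath E lab (w2 ++ (g1 ++ g2) ++ w1) a a :=
    rpath_trans (rpath_trans hf (rpath_trans hg1 hg2)) he
  have hqg : GPath E lab t (w2 ++ (g1 ++ g2) ++ w1) a a :=
    gpath_right (gpath_left hf ⟨g1, g2, rfl, hg1, hg2⟩) he
  set k := Fintype.card S with hk
  refine ih _ hss (w1 ++ wpow (w2 ++ (g1 ++ g2) ++ w1) k) w2
    ⟨e, f, rpath_trans (rpath_trans he (rpath_loop k hq)) hf⟩ ?_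
  intro e' f' h hg
  obtain ⟨F, hF1, hF2, hF3, hF4⟩ := bad_seq hM k e' f' h hg
  have hpath : ∀ j n, j + n ≤ k → RPath E lab (wpow (w2 ++ (g1 ++ g2) ++ w1) n) (F j) (F (j + n)) :=
    fun j n hjn => rpath_wpow j n fun l _ h2 => hF3 l (by omega)
  refine ⟨F k, Finset.mem_erase.2 ⟨?_, hF1 k le_rfl⟩,
    rpath_trans hF2 (by simpa using hpath 0 k (by omega)), hF4⟩
  intro hFk
  obtain ⟨i, j, hij, hFij⟩ : ∃ i j : Fin (k + 1), i ≠ j ∧ F i = F j :=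
    Fintype.exists_ne_map_eq_of_card_lt (fun i : Fin (k + 1) => F i) (by simp [hk])
  obtain ⟨i, j, hij, hj, hFij⟩ : ∃ i j : ℕ, i < j ∧ j ≤ k ∧ F i = F j := by
    rcases lt_or_gt_of_ne hij with h | h
    · exact ⟨i, j, h, by omega, hFij⟩
    · exact ⟨j, i, h, by omega, hFij.symm⟩
  apply hg
  have p1 := hpath 0 i (by omega)
  have p2 := hpath j (k - j) (by omega)
  rw [Nat.zero_add] at p1
  rw [Nat.add_sub_cancel' hj, hFk, ← hFij] at p2
  have p3 := gpath_left (rpath_trans p1 p2) (gpath_loop (j - i) (by omega) hq hqg)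
  rw [← wpow_add, ← wpow_add, show i + (k - j) + (j - i) = k by omega] at p3
  exact gpath_right (gpath_left hF2 p3) (hFk ▸ hF4)

end rel

section abs
variable {Z : Type*} {S : Type*} {L : Type*}

/-- Edges seen in points. -/
def Edge (st : Z → ℤ → S) (a b : S) : Prop := ∃ x m, st x m = a ∧ st x (m + 1) = b

variable {st : Z → ℤ → S} {lab : S → L}

theorem rpath_of_point (x : Z) (n : ℕ) : ∀ m : ℤ,
    RPath (Edge st) lab (List.ofFn fun j : Fin n => lab (st x (m + 1 + (j.1 : ℤ))))
      (st x m) (st x (m + n)) := by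
  induction n with
  | zero => intro m; simp [RPath]
  | succ n ih =>
    intro m
    rw [List.ofFn_succ]
    refine ⟨st x (m + 1), ⟨x, m, rfl, rfl⟩, by simp, ?_⟩
    have h := ih (m + 1)
    have e1 : m + ((n + 1 : ℕ) : ℤ) = m + 1 + n := by push_cast; ring
    rw [e1]
    convert h using 5
    simp
    ring

theorem realize
    (glue : ∀ x x' i i', st x i = st x' i' → ∃ z, (∀ m ≤ i, st z m = st x m) ∧
      ∀ m, i ≤ m → st z m = st x' (m - i + i')) (w : List L) :
    ∀ (a b : S) (x : Z) (i : ℤ), RPath (Edge st) lab w a b → st x i = a →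
      ∃ z, (∀ m ≤ i, st z m = st x m) ∧ st z (i + w.length) = b ∧
        ∀ (j : ℕ) (hj : j < w.length), lab (st z (i + 1 + j)) = w[j] := by
  induction w with
  | nil =>
    intro a b x i h hx
    exact ⟨x, by simp, by simpa [RPath, hx] using h, by simp⟩
  | cons c w ih =>
    rintro a b x i ⟨a', ⟨e, n, he1, he2⟩, hc, h⟩ hx
    obtain ⟨x1, h1, h2⟩ := glue x e i n (hx.trans he1.symm)
    have h3 : st x1 (i + 1) = a' := by
      rw [h2 _ (by omega), ← he2]; congr 1; ring
    obtain ⟨z, hz1, hz2, hz3⟩ := ih a' b x1 (i + 1) h h3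
    refine ⟨z, fun m hm => (hz1 m (by omega)).trans (h1 m hm), ?_, ?_⟩
    · rw [← hz2]; congr 1; simp; ring
    · intro j hj
      rcases j with _ | j
      · simp [hz1, h3, hc]
      · have := hz3 j (by simpa using hj)
        simp only [List.getElem_cons_succ]
        rw [← this]; congr 2; push_cast; ring

theorem exists_good_point [Finite S]
    (glue : ∀ x x' i i', st x i = st x' i' → ∃ z, (∀ m ≤ i, st z m = st x m) ∧
      ∀ m, i ≤ m → st z m = st x' (m - i + i'))
    (conn : ∀ a b : S, ∃ z k, ∃ n : ℕ, st z k = a ∧ st z (k + n) = b) (t : S) :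
    ∃ (y : Z) (o : ℤ) (p : ℕ), ∀ x i,
      (∀ j : ℕ, j < p → lab (st x (i + 1 + j)) = lab (st y (o + 1 + j))) →
      ∃ z, (∀ m ≤ i, st z m = st x m) ∧ (∀ m, i + p ≤ m → st z m = st x m) ∧
        (∀ m, lab (st z m) = lab (st x m)) ∧ ∃ s, i ≤ s ∧ s ≤ i + p ∧ st z s = t := by
  obtain ⟨w, ⟨a, b, hab⟩, hw⟩ := exists_good_word (E := Edge st) (lab := lab) (fun a b => by
    obtain ⟨z, k, n, rfl, rfl⟩ := conn a b
    exact ⟨_, rpath_of_point z n k⟩) t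
  obtain ⟨y0, o, -, ho, -⟩ := conn a a
  obtain ⟨y, -, -, hy⟩ := realize glue w a b y0 o hab ho
  refine ⟨y, o, w.length, ?_⟩
  intro x i hx
  have hx' : RPath (Edge st) lab w (st x i) (st x (i + w.length)) := by
    have h := rpath_of_point (st := st) (lab := lab) x w.length i
    convert h
    apply List.ext_getElem
    · simp
    · intro j h1 h2
      simp only [List.getElem_ofFn]
      rw [hx j h1, hy j h1]
  obtain ⟨w1, w2, rfl, h1, h2⟩ := hw _ _ hx'
  obtain ⟨z1, a1, a2, a3⟩ := realize glue w1 _ _ x i h1 rfl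
  obtain ⟨z2, b1, b2, b3⟩ := realize glue w2 _ _ z1 (i + w1.length) h2 a2
  obtain ⟨z, c1, c2⟩ := glue z2 x _ _ b2
  have e : i + (w1.length : ℤ) + w2.length = i + (w1 ++ w2).length := by simp; ring
  rw [e] at c1 c2
  have hl : ((w1 ++ w2).length : ℤ) = w1.length + w2.length := by simp
  have c2' : ∀ m, i + (w1 ++ w2).length ≤ m → st z m = st x m := by
    intro m hm
    rw [c2 m hm]; congr 1; ring
  have c1' : ∀ m ≤ i, st z m = st x m := fun m hm => by
    rw [c1 m (by omega), b1 m (by omega), a1 m hm]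
  refine ⟨z, c1', c2', ?_, i + w1.length, by omega, by omega, ?_⟩
  · intro m
    rcases le_or_gt m i with h | h
    · rw [c1' m h]
    rcases le_or_gt (i + (w1 ++ w2).length) m with h' | h'
    · rw [c2' m h']
    obtain ⟨j, rfl⟩ : ∃ j : ℕ, m = i + 1 + j := ⟨(m - i - 1).toNat, by omega⟩
    have hj : j < (w1 ++ w2).length := by omega
    rw [hx j hj, hy j hj, c1 _ (by omega)]
    rcases lt_or_ge j w1.length with hjl | hjl
    · rw [b1 _ (by omega), a3 j hjl, List.getElem_append_left hjl]
    · rw [List.getElem_append_right hjl, ← b3 (j - w1.length) (by omega)]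
      congr 2; omega
  · rw [c1 _ (by omega), b1 _ le_rfl, a2]

end abs

section conc
variable {A : Type*} {B : Type*} {X : Set (ℤ → A)} {π : (ℤ → A) → ℤ → B}

/-- Locality of membership and of the code, with radius `R`. -/
structure Loc (X : Set (ℤ → A)) (π : (ℤ → A) → ℤ → B) (R : ℕ) : Prop where
  mem : ∀ z : ℤ → A, (∀ i : ℤ, ∃ x ∈ X, ∃ i' : ℤ, ∀ j : ℤ, |j| ≤ R → z (i + j) = x (i' + j)) → z ∈ X
  code : ∀ (x z : ℤ → A) (m m' : ℤ), (∀ j : ℤ, |j| ≤ R → z (m + j) = x (m' + j)) → π z m = π x m'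

theorem Loc.mono {R R' : ℕ} (h : Loc X π R) (hR : R ≤ R') : Loc X π R' where
  mem := fun z hz => h.mem z fun i => by
    obtain ⟨x, hx, i', h'⟩ := hz i
    exact ⟨x, hx, i', fun j hj => h' j (by omega)⟩
  code := fun x z m m' h' => h.code x z m m' fun j hj => h' j (by omega)

theorem loc_exists [TopologicalSpace A] (hX : IsSFT X) (hπ : IsSlidingBlockCode π) :
    ∃ R, Loc X π R := by
  obtain ⟨-, k, P, rfl⟩ := hX
  obtain ⟨r, Φ, hΦ⟩ := hπ
  refine ⟨k + r, ?_, ?_⟩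
  · intro z hz i
    obtain ⟨x, hx, i', h⟩ := hz i
    convert hx i' using 2 with j
    apply h
    rw [abs_of_nonneg (by omega)]
    have := j.2
    push_cast
    omega
  · intro x z m m' h
    rw [hΦ, hΦ]
    congr 1
    funext j
    have := h (-(r : ℤ) + j) (by have := j.2; rw [abs_le]; push_cast; omega)
    convert this using 2 <;> ring

theorem Loc.glue {R : ℕ} (h : Loc X π R) {x x' : ℤ → A} (hx : x ∈ X) (hx' : x' ∈ X) (c c' : ℤ)
    (hc : ∀ j : ℤ, |j| ≤ R → x (c + j) = x' (c' + j)) :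
    ∃ z ∈ X, (∀ m ≤ c + R, z m = x m) ∧ (∀ m, c - R ≤ m → z m = x' (m - c + c')) ∧
      (∀ m ≤ c, π z m = π x m) ∧ ∀ m, c ≤ m → π z m = π x' (m - c + c') := by
  let z : ℤ → A := fun m => if m ≤ c then x m else x' (m - c + c')
  have key : ∀ m, |m - c| ≤ R → x m = x' (m - c + c') := by
    intro m hm
    convert hc (m - c) hm using 2 <;> ring
  have h1 : ∀ m ≤ c + R, z m = x m := by
    intro m hm
    dsimp only [z]
    split_ifs with h0
    · rfl
    · rw [key m (by rw [abs_le]; omega)]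
  have h2 : ∀ m, c - R ≤ m → z m = x' (m - c + c') := by
    intro m hm
    dsimp only [z]
    split_ifs with h0
    · rw [key m (by rw [abs_le]; omega)]
    · rfl
  have h3 : ∀ i ≤ c, ∀ j : ℤ, |j| ≤ R → z (i + j) = x (i + j) := by
    intro i hi j hj
    rw [abs_le] at hj
    exact h1 _ (by omega)
  have h4 : ∀ i, c ≤ i → ∀ j : ℤ, |j| ≤ R → z (i + j) = x' (i - c + c' + j) := by
    intro i hi j hj
    rw [abs_le] at hj
    rw [h2 _ (by omega)]; congr 1; ring
  refine ⟨z, h.mem z ?_, h1, h2, fun m hm => h.code _ _ _ _ (h3 m hm),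
    fun m hm => h.code _ _ _ _ (h4 m hm)⟩
  intro i
  rcases le_total i c with hi | hi
  · exact ⟨x, hx, i, h3 i hi⟩
  · exact ⟨x', hx', _, h4 i hi⟩

/-- Windows. -/
abbrev Win (A : Type*) (R : ℕ) := Set.Icc (-(R : ℤ)) R → A

def win (R : ℕ) (x : ℤ → A) (m : ℤ) : Win A R := fun j => x (m + j.1)

theorem win_eq {R : ℕ} {x x' : ℤ → A} {m m' : ℤ} :
    win R x m = win R x' m' ↔ ∀ j : ℤ, |j| ≤ R → x (m + j) = x' (m' + j) := by
  constructor
  · intro h j hj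
    exact congrFun h ⟨j, abs_le.1 hj⟩
  · intro h
    funext j
    exact h j.1 (abs_le.2 j.2)

theorem exists_diamond_word [Finite A] [TopologicalSpace A] (hirr : IrreducibleSubshift X)
    {R0 : ℕ} (hloc : Loc X π R0) (t : ℤ → A) (ht : t ∈ X) (N : ℕ) :
    ∃ e ∈ X, ∃ (o : ℤ) (p : ℕ) (Q : ℕ), ∀ x ∈ X, ∀ i : ℤ,
      (∀ j : ℕ, j < p → π x (i + j) = π e (o + j)) →
      ∃ z ∈ X, π z = π x ∧ (∀ m ≤ i - Q, z m = x m) ∧ (∀ m, i + p + Q ≤ m → z m = x m) ∧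
        ∃ s, i - Q ≤ s - N ∧ s + N ≤ i + p + Q ∧ ∀ m : ℤ, |m| ≤ N → z (m + s) = t m := by
  classical
  have hloc' : Loc X π (R0 + N) := hloc.mono (by omega)
  set R := R0 + N with hR
  let S := {a : Win A R // ∃ x ∈ X, ∃ m, win R x m = a}
  let st : X → ℤ → S := fun x m => ⟨win R x.1 m, x.1, x.2, m, rfl⟩
  have st_eq : ∀ (x x' : X) (m m' : ℤ), st x m = st x' m' ↔ win R x.1 m = win R x'.1 m' :=
    fun x x' m m' => Subtype.mk_eq_mk
  let lab : S → B := fun s => π s.2.choose s.2.choose_spec.2.choose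
  have lab_st : ∀ (x : X) m, lab (st x m) = π x.1 m := by
    intro x m
    have h := (st x m).2.choose_spec.2.choose_spec
    exact hloc'.code _ _ _ _ (win_eq.1 h)
  have glue : ∀ (x x' : X) (i i' : ℤ), st x i = st x' i' → ∃ z, (∀ m ≤ i, st z m = st x m) ∧
      ∀ m, i ≤ m → st z m = st x' (m - i + i') := by
    intro x x' i i' h
    rw [st_eq, win_eq] at h
    obtain ⟨z, hz, h1, h2, -, -⟩ := hloc'.glue x.2 x'.2 i i' h
    refine ⟨⟨z, hz⟩, ?_, ?_⟩
    · intro m hm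
      rw [st_eq, win_eq]
      intro j hj
      rw [abs_le] at hj
      exact h1 _ (by omega)
    · intro m hm
      rw [st_eq, win_eq]
      intro j hj
      rw [abs_le] at hj
      exact (h2 _ (by omega)).trans (congrArg x'.1 (by ring))
  have conn : ∀ a b : S, ∃ z k, ∃ n : ℕ, st z k = a ∧ st z (k + n) = b := by
    rintro ⟨_, xa, ha, ma, rfl⟩ ⟨_, xb, hb, mb, rfl⟩
    obtain ⟨z, hz, i, k, hik, h1, h2⟩ := hirr (2 * R + 1) (2 * R + 1)
      (fun j => xa (ma - R + j.1)) (fun j => xb (mb - R + j.1))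
      ⟨xa, ha, _, fun j => rfl⟩ ⟨xb, hb, _, fun j => rfl⟩
    refine ⟨⟨z, hz⟩, i + R, (k - i).toNat, ?_, ?_⟩
    · apply Subtype.ext
      refine win_eq.2 fun j hj => ?_
      rw [abs_le] at hj
      have := h1 ⟨(j + R).toNat, by omega⟩
      dsimp only at this ⊢
      rw [Int.toNat_of_nonneg (by omega)] at this
      convert this using 2 <;> ring
    · apply Subtype.ext
      refine win_eq.2 fun j hj => ?_
      rw [abs_le] at hj
      have := h2 ⟨(j + R).toNat, by omega⟩
      dsimp only at this ⊢
      rw [Int.toNat_of_nonneg (by omega)] at this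
      rw [Int.toNat_of_nonneg (by omega)]
      convert this using 2 <;> ring
  obtain ⟨e, o, p, H⟩ := exists_good_point (lab := lab) glue conn (st ⟨t, ht⟩ 0)
  refine ⟨e.1, e.2, o + 1, p, N + 1, ?_⟩
  intro x hx i hxi
  obtain ⟨z, h1, h2, h3, s, hs1, hs2, hs3⟩ := H ⟨x, hx⟩ (i - 1) (by
    intro j hj
    rw [lab_st, lab_st]
    convert hxi j hj using 2; ring)
  have val : ∀ (u v : X) m, st u m = st v m → u.1 m = v.1 m := by
    intro u v m h
    rw [st_eq, win_eq] at h
    simpa using h 0 (by simp)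
  refine ⟨z.1, z.2, ?_, ?_, ?_, s, by push_cast; omega, by push_cast; omega, ?_⟩
  · funext m
    rw [← lab_st, h3, lab_st]
  · intro m hm
    exact val z ⟨x, hx⟩ m (h1 m (by push_cast at hm; omega))
  · intro m hm
    exact val z ⟨x, hx⟩ m (h2 m (by push_cast at hm; omega))
  · intro m hm
    rw [st_eq, win_eq] at hs3
    have := hs3 m (by omega)
    rw [add_comm m s]; simpa using this

end conc

section final
variable {A : Type*} {B : Type*} {X : Set (ℤ → A)} {Y : Set (ℤ → B)} {π : (ℤ → A) → ℤ → B}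

theorem step_right [Finite A] [TopologicalSpace A] [TopologicalSpace B]
    (hirr : IrreducibleSubshift X)
    {R0 : ℕ} (hloc : Loc X π R0) (hY : IsSubshift Y) (hπ : ∀ x ∈ X, π x ∈ Y)
    {y : ℤ → B} (hy : RightTransitive Y y) (t : ℤ → A) (ht : t ∈ X) (N : ℕ)
    (x : ℤ → A) (hx : x ∈ X) (hxy : π x = y) (b : ℤ) :
    ∃ z ∈ X, π z = y ∧ ∃ b', b ≤ b' ∧ (∀ m ≤ b, z m = x m) ∧ (∀ m, b' ≤ m → z m = x m) ∧
      ∃ s, b ≤ s - N ∧ s + N ≤ b' ∧ ∀ m : ℤ, |m| ≤ N → z (m + s) = t m := by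
  obtain ⟨e, he, o, p, Q, H⟩ := exists_diamond_word hirr hloc t ht N
  obtain ⟨n, hn, hmatch⟩ := hy.2 (shiftMap (o - (b + Q)) (π e)) (hY.2 _ _ (hπ e he))
    (|b + Q| + p).toNat
  obtain ⟨z, hz, h1, h2, h3, s, h4, h5, h6⟩ := H x hx (n + (b + Q)) (by
    intro j hj
    have := hmatch (b + Q + j) (by
      rw [Int.toNat_of_nonneg (by positivity)]
      refine (abs_add_le _ _).trans ?_
      rw [Nat.abs_cast]; omega)
    rw [hxy, show n + (b + Q) + j = b + Q + j + n by ring, this]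
    simp only [shiftMap]
    congr 1; ring)
  exact ⟨z, hz, h1.trans hxy, n + (b + Q) + p + Q, by omega, fun m hm => h2 m (by omega), h3,
    s, by omega, h5, h6⟩

theorem step_left [Finite A] [TopologicalSpace A] [TopologicalSpace B]
    (hirr : IrreducibleSubshift X)
    {R0 : ℕ} (hloc : Loc X π R0) (hY : IsSubshift Y) (hπ : ∀ x ∈ X, π x ∈ Y)
    {y : ℤ → B} (hy : LeftTransitive Y y) (t : ℤ → A) (ht : t ∈ X) (N : ℕ)
    (x : ℤ → A) (hx : x ∈ X) (hxy : π x = y) (b : ℤ) :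
    ∃ z ∈ X, π z = y ∧ ∃ b', b' ≤ b ∧ (∀ m, b ≤ m → z m = x m) ∧ (∀ m ≤ b', z m = x m) ∧
      ∃ s, b' ≤ s - N ∧ s + N ≤ b ∧ ∀ m : ℤ, |m| ≤ N → z (m + s) = t m := by
  obtain ⟨e, he, o, p, Q, H⟩ := exists_diamond_word hirr hloc t ht N
  obtain ⟨n, hn, hmatch⟩ := hy.2 (shiftMap (o - (b - Q - p)) (π e)) (hY.2 _ _ (hπ e he))
    (|b - Q - p| + p).toNat
  obtain ⟨z, hz, h1, h2, h3, s, h4, h5, h6⟩ := H x hx (n + (b - Q - p)) (by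
    intro j hj
    have := hmatch (b - Q - p + j) (by
      rw [Int.toNat_of_nonneg (by positivity)]
      refine (abs_add_le _ _).trans ?_
      rw [Nat.abs_cast]; omega)
    rw [hxy, show n + (b - Q - p) + j = b - Q - p + j + n by ring, this]
    simp only [shiftMap]
    congr 1; ring)
  exact ⟨z, hz, h1.trans hxy, n + (b - Q - p) - Q, by omega, fun m hm => h3 m (by omega), h2,
    s, by omega, by omega, h6⟩

theorem step_both [Finite A] [TopologicalSpace A] [TopologicalSpace B]
    (hirr : IrreducibleSubshift X)
    {R0 : ℕ} (hloc : Loc X π R0) (hY : IsSubshift Y) (hπ : ∀ x ∈ X, π x ∈ Y)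
    {y : ℤ → B} (hy : DoublyTransitive Y y) (t : ℤ → A) (ht : t ∈ X) (N : ℕ)
    (x : ℤ → A) (hx : x ∈ X) (hxy : π x = y) (b : ℕ) :
    ∃ z ∈ X, π z = y ∧ ∃ b' : ℕ, b ≤ b' ∧ (∀ m : ℤ, |m| ≤ b → z m = x m) ∧
      (∀ m : ℤ, (b' : ℤ) ≤ |m| → z m = x m) ∧
      (∃ s : ℤ, 0 ≤ s ∧ s + N ≤ b' ∧ ∀ m : ℤ, |m| ≤ N → z (m + s) = t m) ∧
      (∃ s : ℤ, s ≤ 0 ∧ -(b' : ℤ) ≤ s - N ∧ ∀ m : ℤ, |m| ≤ N → z (m + s) = t m) := by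
  obtain ⟨z1, hz1, h1, b1, hb1, h2, h3, s, h4, h5, h6⟩ :=
    step_right hirr hloc hY hπ hy.1 t ht N x hx hxy b
  obtain ⟨z, hz, k1, b2, hb2, k2, k3, s', k4, k5, k6⟩ :=
    step_left hirr hloc hY hπ hy.2 t ht N z1 hz1 h1 (-b)
  refine ⟨z, hz, k1, (max b1 (-b2)).toNat, by omega, ?_, ?_, ⟨s, by omega, by omega, ?_⟩,
    ⟨s', by omega, by omega, k6⟩⟩
  · intro m hm
    rw [abs_le] at hm
    rw [k2 m (by omega), h2 m (by omega)]
  · intro m hm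
    rw [le_abs] at hm
    rcases hm with hm | hm
    · rw [k2 m (by omega), h3 m (by omega)]
    · rw [k3 m (by omega), h2 m (by omega)]
  · intro m hm
    have := abs_le.1 hm
    rw [k2 _ (by omega), h6 m hm]

/-- Countably many requirements capture all windows of `X`. -/
theorem exists_requirements [Finite A] {x : ℤ → A} (hx : x ∈ X) :
    ∃ f : ℕ → (ℤ → A) × ℕ, (∀ n, (f n).1 ∈ X) ∧ ∀ t ∈ X, ∀ N : ℕ, ∃ n, (f n).2 = N ∧
      ∀ m : ℤ, |m| ≤ N → (f n).1 m = t m := by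
  classical
  let T := Σ N : ℕ, {a : Win A N // ∃ x ∈ X, win N x 0 = a}
  have : Nonempty T := ⟨⟨0, win 0 x 0, x, hx, rfl⟩⟩
  obtain ⟨g, hg⟩ := exists_surjective_nat T
  refine ⟨fun n => ((g n).2.2.choose, (g n).1), fun n => (g n).2.2.choose_spec.1, ?_⟩
  intro t ht N
  obtain ⟨n, hn⟩ := hg ⟨N, win N t 0, t, ht, rfl⟩
  refine ⟨n, by simp [hn], ?_⟩
  have h := (g n).2.2.choose_spec.2
  intro m hm
  dsimp only
  generalize (g n).2.2.choose = c at *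
  rw [hn] at h
  simpa using win_eq.1 h m hm

theorem main [Finite A] [TopologicalSpace A] [TopologicalSpace B]
    (hirr : IrreducibleSubshift X)
    {R : ℕ} (hloc : Loc X π R) (hY : IsSubshift Y) (hπ : ∀ x ∈ X, π x ∈ Y)
    {y : ℤ → B} (hy : DoublyTransitive Y y)
    (x : ℤ → A) (hx : x ∈ X) (hxy : π x = y) :
    ∃ x' ∈ transClass X π x, DoublyTransitive X x' := by
  classical
  obtain ⟨f, hf1, hf2⟩ := exists_requirements hx
  let St := {q : (ℤ → A) × ℕ // q.1 ∈ X ∧ π q.1 = y}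
  have hstep : ∀ (n : ℕ) (q : St), ∃ q' : St, q.1.2 + 2 * R + 1 ≤ q'.1.2 ∧
      (∀ m : ℤ, |m| ≤ q.1.2 + 2 * R + 1 → q'.1.1 m = q.1.1 m) ∧
      (∀ m : ℤ, (q'.1.2 : ℤ) ≤ |m| → q'.1.1 m = q.1.1 m) ∧
      (∃ s : ℤ, 0 ≤ s ∧ s + (f n).2 ≤ q'.1.2 ∧
        ∀ m : ℤ, |m| ≤ (f n).2 → q'.1.1 (m + s) = (f n).1 m) ∧
      (∃ s : ℤ, s ≤ 0 ∧ -(q'.1.2 : ℤ) ≤ s - (f n).2 ∧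
        ∀ m : ℤ, |m| ≤ (f n).2 → q'.1.1 (m + s) = (f n).1 m) := by
    rintro n ⟨⟨u, b⟩, hu1, hu2⟩
    obtain ⟨z, hz, h1, b', h2, h3, h4, h5, h6⟩ := step_both hirr hloc hY hπ hy (f n).1 (hf1 n)
      (f n).2 u hu1 hu2 (b + 2 * R + 1)
    exact ⟨⟨(z, b'), hz, h1⟩, h2, by simpa using h3, h4, h5, h6⟩
  choose F hF1 hF2 hF3 hF4 hF5 using hstep
  let q : ℕ → St := fun n => Nat.rec ⟨(x, 0), hx, hxy⟩ (fun n s => F n s) n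
  have q0 : q 0 = ⟨(x, 0), hx, hxy⟩ := rfl
  have qs : ∀ n, q (n + 1) = F n (q n) := fun n => rfl
  let b : ℕ → ℕ := fun n => (q n).1.2
  let u : ℕ → ℤ → A := fun n => (q n).1.1
  have hb : ∀ n, b n + 2 * R + 1 ≤ b (n + 1) := fun n => hF1 n (q n)
  have hbm : Monotone b := monotone_nat_of_le_succ fun n => by have := hb n; omega
  have hbn : ∀ n, n ≤ b n := by
    intro n
    induction n with
    | zero => omega
    | succ n ih => have := hb n; omega
  have hu : ∀ n, ∀ m : ℤ, |m| ≤ b n + 2 * R + 1 → u (n + 1) m = u n m := fun n => hF2 n (q n)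
  have hout : ∀ n, ∀ m : ℤ, (b n : ℤ) ≤ |m| → u n m = x m := by
    intro n
    induction n with
    | zero => intro m _; rfl
    | succ n ih =>
      intro m hm
      have := hb n
      exact (hF3 n (q n) m hm).trans (ih m (by omega))
  have hst : ∀ n k, ∀ m : ℤ, |m| ≤ b n → u (n + k) m = u n m := by
    intro n k
    induction k with
    | zero => intro m _; rfl
    | succ k ih =>
      intro m hm
      have := hbm (Nat.le_add_right n k)
      rw [← ih m hm]
      exact hu (n + k) m (by omega)
  let x' : ℤ → A := fun m => u m.natAbs m
  have hx'u : ∀ n, ∀ m : ℤ, |m| ≤ b n → x' m = u n m := by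
    intro n m hm
    have h1 : |m| ≤ b m.natAbs := by have := hbn m.natAbs; rw [abs_le]; omega
    rcases le_total n m.natAbs with h | h
    · obtain ⟨k, hk⟩ := Nat.exists_eq_add_of_le h
      have := hst n k m hm
      rw [← hk] at this
      exact this
    · obtain ⟨k, hk⟩ := Nat.exists_eq_add_of_le h
      have := hst m.natAbs k m h1
      rw [← hk] at this
      exact this.symm
  have hloc1 : ∀ i : ℤ, ∀ j : ℤ, |j| ≤ R → x' (i + j) = u (i.natAbs + R) (i + j) := by
    intro i j hj
    apply hx'u
    have := hbn (i.natAbs + R)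
    rw [abs_le] at hj ⊢
    omega
  have hx' : x' ∈ X := hloc.mem x' fun i => ⟨u (i.natAbs + R), (q _).2.1, i, hloc1 i⟩
  have hπx' : π x' = y := by
    funext i
    rw [hloc.code _ _ i i (hloc1 i)]
    exact congrFun (q _).2.2 i
  have hagree : ∀ n, ∀ j : ℤ, |j| ≤ R → x' (b n + R + j) = x (b n + R + j) := by
    intro n j hj
    rw [abs_le] at hj
    have h0 : |(b n : ℤ) + R + j| = b n + R + j := abs_of_nonneg (by omega)
    rw [hx'u (n + 1) _ (by have := hb n; omega), hu n _ (by omega), hout n _ (by omega)]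
  have htrans : ∀ v v' : ℤ → A, v ∈ X → v' ∈ X → π v = y → π v' = y →
      (∀ n, ∀ j : ℤ, |j| ≤ R → v (b n + R + j) = v' (b n + R + j)) → TransitionTo X π v v' := by
    intro v v' hv hv' hvy hvy' hag n
    have hbn' := hbn n.natAbs
    obtain ⟨z, hz, h1, h2, h3, h4⟩ := hloc.glue hv hv' _ _ (hag n.natAbs)
    refine ⟨z, hz, ?_, fun m hm => h1 m (by omega), b n.natAbs + R, by omega, ?_⟩
    · funext m
      rcases le_total m (b n.natAbs + R) with h | h
      · exact h3 m h
      · rw [h4 m h, hvy, hvy']; congr 1; ring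
    · intro m hm
      rw [h2 m (by omega)]; congr 1; ring
  refine ⟨x', ⟨hx', hπx'.trans hxy.symm, htrans x x' hx hx' hxy hπx' fun n j hj =>
    (hagree n j hj).symm, htrans x' x hx' hx hπx' hxy hagree⟩, ⟨hx', ?_⟩, hx', ?_⟩
  · intro t ht N
    obtain ⟨n, rfl, hn⟩ := hf2 t ht N
    obtain ⟨s, hs1, hs2, hs3⟩ := hF4 n (q n)
    refine ⟨s, hs1, fun m hm => ?_⟩
    rw [← hn m hm, ← hs3 m hm]
    apply hx'u (n + 1)
    change s + ((f n).2 : ℤ) ≤ b (n + 1) at hs2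
    rw [abs_le] at hm ⊢
    omega
  · intro t ht N
    obtain ⟨n, rfl, hn⟩ := hf2 t ht N
    obtain ⟨s, hs1, hs2, hs3⟩ := hF5 n (q n)
    refine ⟨s, hs1, fun m hm => ?_⟩
    rw [← hn m hm, ← hs3 m hm]
    apply hx'u (n + 1)
    change -(b (n + 1) : ℤ) ≤ s - ((f n).2 : ℤ) at hs2
    rw [abs_le] at hm ⊢
    omega

end final

end TC

theorem transClass_contains_doublyTransitive [Fintype A] [TopologicalSpace A] [DiscreteTopology A]
    [Fintype B] [TopologicalSpace B] [DiscreteTopology B]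
    (X : Set (ℤ → A)) (Y : Set (ℤ → B)) (π : (ℤ → A) → ℤ → B)
    (hT : FactorTriple X Y π) (hXirr : IrreducibleSubshift X)
    (y : ℤ → B) (hy : DoublyTransitive Y y) :
    ∀ C ∈ transClassesOver X π y, ∃ x ∈ C, DoublyTransitive X x := by
  rintro C ⟨x, hx, hxy, rfl⟩
  obtain ⟨hX, hY, hc, hπ, -⟩ := hT
  obtain ⟨R, hloc⟩ := TC.loc_exists hX hc
  exact TC.main hXirr hloc hY hπ hy x hx hxy
end
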